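/- arXiv:2105.09181 — 4 statements merged into one kernel-verified Lean document; each statement's English description precedes it below -/
import Mathlib

section
/- Let A ⊂ ℤ be a finite set with |A| ≥ 3, min A = 0, max A = b, and gcd of the elements of A equal to 1. Then for every integer N ≥ b − 1: (i) NA = ({0, 1, …, bN} ∩ ℤ) ∖ (E(A) ∪ (bN − E(b−A))); and (ii) there exists a polynomial P ∈ ℚ[X] with |NA| = P(N) for all such N. (Equivalently, N_Str(A) ≤ w(A) − 1 and N_Kh(A) ≤ w(A) − 1, where w(A) = b is the width of A.) -/
open Pointwise MeasureTheory

noncomputable section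

/-- Embedding of integer vectors into real vectors. -/
def emb (d : ℕ) : (Fin d → ℤ) → (Fin d → ℝ) := fun x i => (x i : ℝ)

/-- The `N`-fold sumset `NA` (with `0·A = {0}`). -/
def nfold (d : ℕ) (A : Set (Fin d → ℤ)) (N : ℕ) : Set (Fin d → ℤ) :=
  {x | ∃ f : Fin N → (Fin d → ℤ), (∀ i, f i ∈ A) ∧ x = ∑ i, f i}

/-- `P(A) = ⋃_{N ≥ 1} NA`. -/
def PA (d : ℕ) (A : Set (Fin d → ℤ)) : Set (Fin d → ℤ) :=
  ⋃ N ∈ Set.Ici 1, nfold d A N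

/-- The width `w(A) = max_{a₁,a₂ ∈ A} ‖a₁ - a₂‖_∞`. -/
def width (d : ℕ) (A : Finset (Fin d → ℤ)) : ℕ :=
  (A ×ˢ A).sup fun p => Finset.univ.sup fun i => (p.1 i - p.2 i).natAbs

/-- The convex hull `H(A)` in `ℝ^d`. -/
def hull (d : ℕ) (A : Finset (Fin d → ℤ)) : Set (Fin d → ℝ) :=
  convexHull ℝ (emb d '' ↑A)

/-- The cone `C_B = {∑_{b ∈ B} c_b b : c_b ≥ 0}` generated by `B`. -/
def cone (d : ℕ) (B : Finset (Fin d → ℤ)) : Set (Fin d → ℝ) :=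
  {x | ∃ c : (Fin d → ℤ) → ℝ, (∀ a, 0 ≤ c a) ∧ x = ∑ a ∈ B, c a • emb d a}

/-- The lattice (subgroup of `ℤ^d`) generated by a set `S`. -/
def latt (d : ℕ) (S : Set (Fin d → ℤ)) : AddSubgroup (Fin d → ℤ) :=
  AddSubgroup.closure S

/-- The exceptional set `E(A) = (C_A ∩ Λ_A) ∖ P(A)`, viewed inside `ℤ^d`. -/
def excep (d : ℕ) (A : Finset (Fin d → ℤ)) : Set (Fin d → ℤ) :=
  {x | emb d x ∈ cone d A ∧ x ∈ latt d ↑A ∧ x ∉ PA d ↑A}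

/-- The set of (lattice) extreme points of `H(A)`: those `p` with `emb p ∈ H(A)` such that
some `v ∈ span ℝ (A - A)`, `v ≠ 0`, satisfies `⟨v,x⟩ > ⟨v,p⟩` for all `x ∈ H(A) ∖ {p}`. -/
def exP (d : ℕ) (A : Finset (Fin d → ℤ)) : Set (Fin d → ℤ) :=
  {p | emb d p ∈ hull d A ∧
    ∃ v ∈ Submodule.span ℝ (emb d '' ((A : Set (Fin d → ℤ)) - (A : Set (Fin d → ℤ)))),
      v ≠ (0 : Fin d → ℝ) ∧
      ∀ x ∈ hull d A, x ≠ emb d p → (∑ i, v i * emb d p i) < ∑ i, v i * x i}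

/-- The structure equation
`NA = (N·H(A) ∩ (N·a₀ + Λ_{A-A})) ∖ ⋃_{a ∈ ex(H(A))} (N·a - E(a - A))`. -/
def structEq (d : ℕ) (A : Finset (Fin d → ℤ)) (a0 : Fin d → ℤ) (N : ℕ) : Prop :=
  emb d '' nfold d ↑A N =
    ((N : ℝ) • hull d A ∩
      emb d '' (({N • a0} : Set (Fin d → ℤ)) +
        (latt d ((A : Set (Fin d → ℤ)) - (A : Set (Fin d → ℤ))) : Set (Fin d → ℤ)))) \
    ⋃ a ∈ exP d A,
      emb d '' (({N • a} : Set (Fin d → ℤ)) - excep d (A.image fun y => a - y))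

/-- `H(A)` is a `d`-simplex: there is `B ⊆ A` with `|B| = d+1`, `B - B` spanning `ℝ^d`,
and `H(A) = H(B)`. -/
def IsSimplex (d : ℕ) (A : Finset (Fin d → ℤ)) : Prop :=
  ∃ B ⊆ A, B.card = d + 1 ∧
    Submodule.span ℝ (emb d '' ((B : Set (Fin d → ℤ)) - (B : Set (Fin d → ℤ)))) = ⊤ ∧
    hull d B = hull d A

/-- `N_A(v)`: the minimal positive `N` with `v ∈ NA`, and `N_A(0) = 0`. -/
def NAfn (d : ℕ) (A : Set (Fin d → ℤ)) (v : Fin d → ℤ) : ℕ :=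
  if v = 0 then 0 else sInf {N : ℕ | 0 < N ∧ v ∈ nfold d A N}

/-- The set `S(A,B)` of `B`-minimal elements. -/
def Smin (d : ℕ) (A B : Set (Fin d → ℤ)) : Set (Fin d → ℤ) :=
  {0} ∪ {u | u ∈ PA d A ∧ u ≠ 0 ∧
    ∀ f : Fin (NAfn d A u) → (Fin d → ℤ), (∀ i, f i ∈ A) → u = ∑ i, f i →
      ∀ i, f i ∉ B ∪ ({0} : Set (Fin d → ℤ))}

/-- The `N`-fold sumset in `ℤ`. -/
def nfold1 (A : Set ℤ) (N : ℕ) : Set ℤ :=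
  {x | ∃ f : Fin N → ℤ, (∀ i, f i ∈ A) ∧ x = ∑ i, f i}

/-- `P(A) = ⋃_{N ≥ 1} NA` in `ℤ`. -/
def PA1 (A : Set ℤ) : Set ℤ := ⋃ N ∈ Set.Ici 1, nfold1 A N

/-- The one-dimensional exceptional set `E(A) = ℤ_{≥0} ∖ P(A)`. -/
def E1 (A : Set ℤ) : Set ℤ := {n | 0 ≤ n ∧ n ∉ PA1 A}

/-- A multiset of integers with no nonempty sub-multiset whose sum is divisible by `b`. -/
def ZeroSumFree (b : ℤ) (m : Multiset ℤ) : Prop :=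
  ∀ t ≤ m, b ∣ t.sum → t = 0

theorem ZeroSumFree.mono {b : ℤ} {m m' : Multiset ℤ} (h : ZeroSumFree b m) (hm : m' ≤ m) :
    ZeroSumFree b m' :=
  fun t ht hb => h t (ht.trans hm) hb

theorem exists_zeroSumFree_add (b : ℤ) (m : Multiset ℤ) :
    ∃ m' t, m = m' + t ∧ ZeroSumFree b m' ∧ b ∣ t.sum := by
  induction hn : m.card using Nat.strong_induction_on generalizing m with
  | _ n ih =>
    by_cases h : ZeroSumFree b m
    · exact ⟨m, 0, by simp, h, by simp⟩
    · simp only [ZeroSumFree, not_forall] at h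
      obtain ⟨t, ht, hb, h0⟩ := h
      obtain ⟨r, rfl⟩ := Multiset.le_iff_exists_add.1 ht
      have hpos : 0 < t.card := Multiset.card_pos.2 h0
      obtain ⟨m', t', rfl, hm', ht'⟩ := ih r.card (by rw [← hn, Multiset.card_add]; omega) r rfl
      refine ⟨m', t' + t, by abel, hm', ?_⟩
      rw [Multiset.sum_add]
      exact dvd_add ht' hb

theorem ZeroSumFree.take_sum_emod_injOn {b : ℤ} {l : List ℤ}
    (h : ZeroSumFree b (l : Multiset ℤ)) :
    Set.InjOn (fun i => (l.take i).sum % b) (Set.Iic l.length) := by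
  have key : ∀ i j, i < j → j ≤ l.length → (l.take i).sum % b ≠ (l.take j).sum % b := by
    intro i j hij hj he
    have hsplit : (l.take j).sum = (l.take i).sum + ((l.take j).drop i).sum := by
      rw [← List.sum_take_add_sum_drop (l.take j) i, List.take_take, min_eq_left hij.le]
    have hd : b ∣ ((l.take j).drop i).sum := by
      have := Int.ModEq.dvd (show (l.take i).sum ≡ (l.take j).sum [ZMOD b] from he)
      rwa [hsplit, add_sub_cancel_left] at this
    have hnil := h ((l.take j).drop i : List ℤ)
      (((List.drop_sublist _ _).trans (List.take_sublist _ _)).subperm) (by simpa using hd)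
    have := congrArg Multiset.card hnil
    simp at this
    omega
  intro i hi j hj he
  rcases lt_trichotomy i j with hij | hij | hij
  · exact (key i j hij hj he).elim
  · exact hij
  · exact (key j i hij hi he.symm).elim

theorem ZeroSumFree.card_lt {b : ℤ} (hb : 0 < b) {m : Multiset ℤ} (h : ZeroSumFree b m) :
    (m.card : ℤ) < b := by
  induction m using Quotient.inductionOn with
  | _ l =>
    have hinj := h.take_sum_emod_injOn
    have hcard := Finset.card_le_card_of_injOn (s := Finset.Iic l.length)
      (t := Finset.Ico 0 b) (fun i => (l.take i).sum % b)
      (fun i _ => by simp [Int.emod_nonneg _ hb.ne', Int.emod_lt_of_pos _ hb])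
      (by simpa using hinj)
    simp at hcard
    simp
    omega

theorem exists_take_sum_modEq {b : ℤ} (hb : 0 < b) {l l' : List ℤ}
    (h : ZeroSumFree b (l : Multiset ℤ)) (h' : ZeroSumFree b (l' : Multiset ℤ))
    (hlen : b < l.length + l'.length) :
    ∃ i ≤ l.length, ∃ k, 0 < k ∧ k < l'.length ∧
      (l.take i).sum ≡ (l'.take k).sum [ZMOD b] := by
  by_contra! hne
  have hdisj : Disjoint ((Finset.Iic l.length).image fun i => (l.take i).sum % b)
      ((Finset.Ioo 0 l'.length).image fun i => (l'.take i).sum % b) := by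
    rw [Finset.disjoint_left]
    simp only [Finset.mem_image, Finset.mem_Iic, Finset.mem_Ioo]
    rintro _ ⟨i, hi, rfl⟩ ⟨k, hk, he⟩
    exact hne i hi k hk.1 hk.2 he.symm
  have hsub : ((Finset.Iic l.length).image fun i => (l.take i).sum % b) ∪
      ((Finset.Ioo 0 l'.length).image fun i => (l'.take i).sum % b) ⊆ Finset.Ico 0 b := by
    intro y hy
    simp only [Finset.mem_union, Finset.mem_image] at hy
    rcases hy with ⟨i, -, rfl⟩ | ⟨i, -, rfl⟩ <;>
      simp [Int.emod_nonneg _ hb.ne', Int.emod_lt_of_pos _ hb]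
  have hcard := Finset.card_le_card hsub
  rw [Finset.card_union_of_disjoint hdisj,
    Finset.card_image_of_injOn (by simpa using h.take_sum_emod_injOn),
    Finset.card_image_of_injOn (h'.take_sum_emod_injOn.mono (by
      intro i hi
      simp at hi ⊢
      omega))] at hcard
  have := h.card_lt hb
  have := h'.card_lt hb
  simp at hcard this
  omega

theorem sum_nonneg_and_le {b : ℤ} {m : Multiset ℤ} (h : ∀ a ∈ m, 0 ≤ a ∧ a ≤ b) :
    0 ≤ m.sum ∧ m.sum ≤ b * m.card := by
  refine ⟨Multiset.sum_nonneg fun a ha => (h a ha).1, ?_⟩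
  have := Multiset.sum_le_card_nsmul m b fun a ha => (h a ha).2
  rw [nsmul_eq_mul] at this
  linarith

/-- If `x` is the sum of some multiset of elements of `A`, and `b * N - x` is the sum of some
multiset of elements of `b - A`, then `x` is the sum of exactly `N` elements of `A`. -/
theorem exists_card_eq_sum_eq {A : Finset ℤ} {b : ℤ} (hb : 0 < b) (h0 : 0 ∈ A) (hbA : b ∈ A)
    (hA : ∀ a ∈ A, 0 ≤ a ∧ a ≤ b) {N : ℕ} (hN : b - 1 ≤ N) {x : ℤ}
    {U S : Multiset ℤ} (hU : ∀ a ∈ U, a ∈ A) (hS : ∀ a ∈ S, a ∈ A)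
    (hUx : U.sum = x) (hSx : b * S.card - S.sum = b * N - x) :
    ∃ m : Multiset ℤ, m.card = N ∧ (∀ a ∈ m, a ∈ A) ∧ m.sum = x := by
  by_contra hcon
  have hunc : ∀ m : Multiset ℤ, (∀ a ∈ m, a ∈ A) → ∀ j : ℤ, x = m.sum + b * j → 0 ≤ j →
      (N : ℤ) < j + m.card := by
    intro m hm j hj hj0
    by_contra! hle
    lift j to ℕ using hj0
    refine hcon ⟨m + Multiset.replicate j b + Multiset.replicate (N - j - m.card) 0, ?_, ?_, ?_⟩
    · simp
      omega
    · intro a ha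
      simp only [Multiset.mem_add] at ha
      rcases ha with (ha | ha) | ha
      · exact hm a ha
      · rwa [Multiset.eq_of_mem_replicate ha]
      · rwa [Multiset.eq_of_mem_replicate ha]
    · simp [hj, mul_comm]
  let Good : Multiset ℤ → ℤ → Prop := fun m j =>
    (∀ a ∈ m, a ∈ A) ∧ ZeroSumFree b m ∧ x = m.sum + b * j
  have hred : ∀ m : Multiset ℤ, (∀ a ∈ m, a ∈ A) → ∀ j : ℤ, x = m.sum + b * j →
      ∃ m' ≤ m, ∃ j', Good m' j' ∧ j ≤ j' ∧ j' + m'.card ≤ j + m.card := by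
    intro m hm j hj
    obtain ⟨m', t, rfl, hz, f, hf⟩ := exists_zeroSumFree_add b m
    have ht := sum_nonneg_and_le (b := b) (m := t)
      fun a ha => hA a (hm a (Multiset.mem_add.2 (Or.inr ha)))
    rw [hf] at ht
    have hf0 : 0 ≤ f := nonneg_of_mul_nonneg_right ht.1 hb
    have hf1 : f ≤ t.card := le_of_mul_le_mul_left ht.2 hb
    refine ⟨m', Multiset.le_add_right _ _, j + f,
      ⟨fun a ha => hm a (Multiset.mem_add.2 (Or.inl ha)), hz, ?_⟩, by omega, ?_⟩
    · rw [hj, Multiset.sum_add, hf]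
      ring
    · rw [Multiset.card_add]
      push_cast
      omega
  have hnone : ∀ n : ℕ, ∀ W Z : Multiset ℤ, (W ∪ Z).card = n →
      ∀ jW jZ : ℤ, Good W jW → (N : ℤ) < jW + W.card → Good Z jZ → jZ < 0 → False := by
    intro n
    induction n using Nat.strong_induction_on with
    | _ n ih =>
    intro W Z hn jW jZ hW hWl hZ hZr
    obtain ⟨X, hX⟩ := Multiset.le_iff_exists_add.1 (Multiset.inter_le_left : W ∩ Z ≤ W)
    obtain ⟨Y, hY⟩ := Multiset.le_iff_exists_add.1 (Multiset.inter_le_right : W ∩ Z ≤ Z)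
    have hun := congrArg Multiset.card (Multiset.union_add_inter W Z)
    rw [Multiset.card_add, Multiset.card_add, hn] at hun
    generalize W ∩ Z = C at hX hY hun
    subst hX hY
    obtain ⟨hWA, hWz, hWx⟩ := hW
    obtain ⟨hZA, hZz, hZx⟩ := hZ
    have hcW := hWz.card_lt hb
    simp only [Multiset.card_add, Multiset.sum_add] at *
    have hX0 : 0 ≤ X.sum := Multiset.sum_nonneg fun a ha =>
      (hA a (hWA a (Multiset.mem_add.2 (Or.inr ha)))).1
    have hY1 : Y.sum ≤ (b - 1) * Y.card := by
      refine (sum_nonneg_and_le fun a ha => ?_).2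
      have haA := hZA a (Multiset.mem_add.2 (Or.inr ha))
      refine ⟨(hA a haA).1, ?_⟩
      by_contra! hlt
      have hab : a = b := by have := (hA a haA).2; omega
      have := hZz {a} (by
        rw [Multiset.singleton_le]
        exact Multiset.mem_add.2 (Or.inr ha)) (by simp [hab])
      simp at this
    have hYX : Y.sum - X.sum = b * (jW - jZ) := by linarith
    have hlen : (N : ℤ) + 3 ≤ C.card + X.card + Y.card := by
      push_cast at *
      by_contra! hlt
      have h2 : (Y.card : ℤ) ≤ jW - jZ := by omega
      have h3 : (2 : ℤ) ≤ jW - jZ := by omega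
      rcases Nat.eq_zero_or_pos Y.card with hY0 | hY0
      · rw [hY0, Nat.cast_zero, mul_zero] at hY1
        nlinarith
      · have : (0 : ℤ) < Y.card := by exact_mod_cast hY0
        nlinarith
    induction X using Quotient.inductionOn with | _ lx =>
    induction Y using Quotient.inductionOn with | _ ly =>
    induction C using Quotient.inductionOn with | _ lc =>
    simp only [Multiset.quot_mk_to_coe, Multiset.coe_card, Multiset.sum_coe] at *
    obtain ⟨i, hi, k, hk0, hk, hmod⟩ := exists_take_sum_modEq hb (l := lx ++ lc) (l' := ly)
      (hWz.mono (by
        rw [← Multiset.coe_add, add_comm])) (hZz.mono (Multiset.le_add_left _ _)) (by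
        simp only [List.length_append]
        push_cast
        omega)
    have hdvd := hmod.dvd
    have hYs := List.sum_take_add_sum_drop ly k
    have hYdrop : ((ly.drop k : List ℤ) : Multiset ℤ) ≤ ly := (List.drop_sublist k ly).subperm
    rcases le_or_gt i lx.length with hil | hil
    · rw [List.take_append_of_le_length hil] at hdvd
      have hXtake : ((lx.take i : List ℤ) : Multiset ℤ) ≤ lx := (List.take_sublist i lx).subperm
      have hilt : i < lx.length := by
        refine lt_of_le_of_ne hil fun he => ?_
        rw [he, List.take_length] at hdvd
        have := hZz (ly.drop k : List ℤ) (hYdrop.trans (Multiset.le_add_left _ _)) (by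
          have he : (ly.drop k).sum = ly.sum - lx.sum - ((ly.take k).sum - lx.sum) := by linarith
          rw [Multiset.sum_coe, he, hYX]
          exact dvd_sub (dvd_mul_right _ _) hdvd)
        have := congrArg Multiset.card this
        simp at this
        omega
      obtain ⟨f, hf⟩ := hdvd
      obtain ⟨m', hm', j', hg, -, -⟩ := hred
        (lc + ((lx.take i : List ℤ) : Multiset ℤ) + ((ly.drop k : List ℤ) : Multiset ℤ)) (by
          intro a ha
          rw [Multiset.mem_add] at ha
          rcases ha with ha | ha
          · exact hWA a (Multiset.mem_of_le (by gcongr) ha)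
          · exact hZA a (Multiset.mem_add.2 (Or.inr (Multiset.mem_of_le hYdrop ha))))
        (jZ + f) (by
          simp only [Multiset.sum_add, Multiset.sum_coe]
          linarith)
      rcases lt_or_ge j' 0 with hj' | hj'
      · have hle : ((lc : Multiset ℤ) + (lx : Multiset ℤ)) ∪ m' ≤
            (lc : Multiset ℤ) + lx + ((ly.drop k : List ℤ) : Multiset ℤ) :=
          Multiset.union_le (Multiset.le_add_right _ _) (hm'.trans (by gcongr))
        refine ih _ ?_ (lc + lx) m' rfl jW j' ⟨hWA, hWz, by simpa using hWx⟩ (by simpa using hWl)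
          hg hj'
        have := Multiset.card_le_card hle
        simp only [Multiset.card_add, Multiset.coe_card, List.length_drop] at this
        omega
      · have hle : m' ∪ ((lc : Multiset ℤ) + (ly : Multiset ℤ)) ≤
            (lc : Multiset ℤ) + ((lx.take i : List ℤ) : Multiset ℤ) + ly :=
          Multiset.union_le (hm'.trans (by gcongr)) (by gcongr; exact Multiset.le_add_right _ _)
        refine ih _ ?_ m' (lc + ly) rfl j' jZ hg (hunc m' hg.1 j' hg.2.2 hj')
          ⟨hZA, hZz, by simpa using hZx⟩ hZr
        have := Multiset.card_le_card hle
        simp only [Multiset.card_add, Multiset.coe_card, List.length_take] at this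
        omega
    · obtain ⟨p, rfl⟩ := Nat.exists_eq_add_of_le hil.le
      rw [List.take_length_add_append, List.sum_append] at hdvd
      have := hZz (((lc.take p : List ℤ) : Multiset ℤ) + ((ly.drop k : List ℤ) : Multiset ℤ))
        (add_le_add (List.take_sublist p lc).subperm hYdrop) (by
          have he : (lc.take p).sum + (ly.drop k).sum =
              ly.sum - lx.sum - ((ly.take k).sum - (lx.sum + (lc.take p).sum)) := by linarith
          rw [Multiset.sum_add, Multiset.sum_coe, Multiset.sum_coe, he, hYX]
          exact dvd_sub (dvd_mul_right _ _) hdvd)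
      have := congrArg Multiset.card this
      simp at this
      omega
  obtain ⟨W, -, jW, hW, hjW, -⟩ := hred U hU 0 (by simp [hUx])
  obtain ⟨Z, -, jZ, hZ, -, hjZ⟩ := hred S hS (N - S.card) (by linarith)
  have hZr : jZ < 0 := by
    by_contra! hj
    have := hunc Z hZ.1 jZ hZ.2.2 hj
    omega
  exact hnone _ W Z rfl jW jZ hW (hunc W hW.1 jW hW.2.2 hjW) hZ hZr

theorem mem_nfold1_iff {A : Set ℤ} {N : ℕ} {x : ℤ} :
    x ∈ nfold1 A N ↔ ∃ m : Multiset ℤ, m.card = N ∧ (∀ a ∈ m, a ∈ A) ∧ m.sum = x := by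
  constructor
  · rintro ⟨f, hf, rfl⟩
    refine ⟨Finset.univ.val.map f, by simp, ?_, rfl⟩
    simpa using hf
  · rintro ⟨m, rfl, hm, rfl⟩
    induction m using Quotient.inductionOn with | _ l =>
    refine ⟨fun i => l.get i, fun i => hm _ (List.get_mem l i), ?_⟩
    simp only [Multiset.quot_mk_to_coe, Multiset.sum_coe]
    exact (Fin.sum_univ_getElem l).symm

theorem mem_PA1_iff {A : Set ℤ} (h0 : 0 ∈ A) {x : ℤ} :
    x ∈ PA1 A ↔ ∃ m : Multiset ℤ, (∀ a ∈ m, a ∈ A) ∧ m.sum = x := by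
  simp only [PA1, Set.mem_iUnion, Set.mem_Ici, mem_nfold1_iff]
  constructor
  · rintro ⟨N, -, m, -, hm, rfl⟩
    exact ⟨m, hm, rfl⟩
  · rintro ⟨m, hm, rfl⟩
    refine ⟨m.card + 1, by omega, 0 ::ₘ m, by simp, ?_, by simp⟩
    simpa using ⟨h0, hm⟩

theorem mem_PA1_sub_iff {A : Finset ℤ} {b : ℤ} (hbA : b ∈ A) {y : ℤ} :
    y ∈ PA1 ↑(A.image fun a => b - a) ↔
      ∃ m : Multiset ℤ, (∀ a ∈ m, a ∈ A) ∧ b * m.card - m.sum = y := by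
  have hsum : ∀ m : Multiset ℤ, (m.map fun a => b - a).sum = b * m.card - m.sum := by
    intro m
    rw [Multiset.sum_map_sub]
    simp [mul_comm]
  rw [mem_PA1_iff (by simpa using ⟨b, hbA, by simp⟩)]
  constructor
  · rintro ⟨m, hm, rfl⟩
    refine ⟨m.map fun a => b - a, ?_, ?_⟩
    · intro a ha
      obtain ⟨c, hc, rfl⟩ := Multiset.mem_map.1 ha
      obtain ⟨d, hd, rfl⟩ := Finset.mem_image.1 (hm c hc)
      simpa using hd
    · rw [hsum, Multiset.card_map]
      ring
  · rintro ⟨m, hm, rfl⟩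
    refine ⟨m.map fun a => b - a, ?_, hsum m⟩
    intro a ha
    obtain ⟨c, hc, rfl⟩ := Multiset.mem_map.1 ha
    exact Finset.mem_coe.2 (Finset.mem_image_of_mem _ (hm c hc))

theorem exists_sum_modEq {A : Finset ℤ} {b : ℤ} (hb : 0 < b) (hgcd : A.gcd id = 1) (x : ℤ) :
    ∃ m : Multiset ℤ, (∀ a ∈ m, a ∈ A) ∧ (m.card : ℤ) < b ∧ b ∣ x - m.sum := by
  obtain ⟨d, hd⟩ := IsPrincipalIdealRing.principal (Ideal.span (A : Set ℤ))
  have hd1 : d ∣ 1 := by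
    rw [← hgcd]
    refine Finset.dvd_gcd fun a ha => Ideal.mem_span_singleton.1 ?_
    rw [Ideal.span, ← hd]
    exact Ideal.subset_span ha
  have h1 : (1 : ℤ) ∈ Ideal.span (A : Set ℤ) := by
    rw [hd]
    exact Ideal.mem_span_singleton.2 hd1
  obtain ⟨g, -, hg⟩ := Submodule.mem_span_finset.1 h1
  obtain ⟨m', t, hm, hz, ht⟩ := exists_zeroSumFree_add b
    (∑ a ∈ A, Multiset.replicate ((x * g a) % b).toNat a)
  refine ⟨m', ?_, hz.card_lt hb, ?_⟩
  · intro a ha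
    have : a ∈ ∑ a ∈ A, Multiset.replicate ((x * g a) % b).toNat a :=
      hm ▸ Multiset.mem_add.2 (Or.inl ha)
    obtain ⟨c, hc, hac⟩ := Multiset.mem_sum.1 this
    rwa [Multiset.eq_of_mem_replicate hac]
  · have hsum : m'.sum + t.sum = ∑ a ∈ A, ((x * g a) % b) * a := by
      rw [← Multiset.sum_add, ← hm, Multiset.sum_sum]
      refine Finset.sum_congr rfl fun a _ => ?_
      rw [Multiset.sum_replicate, nsmul_eq_mul, Int.toNat_of_nonneg (Int.emod_nonneg _ hb.ne')]
    have hx : x = ∑ a ∈ A, (x * g a) * a := by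
      calc x = x * 1 := (mul_one x).symm
        _ = _ := by
          rw [← hg, Finset.mul_sum]
          exact Finset.sum_congr rfl fun a _ => by rw [smul_eq_mul, mul_assoc]
    have hd : b ∣ x - (m'.sum + t.sum) := by
      rw [hsum]
      nth_rewrite 1 [hx]
      rw [← Finset.sum_sub_distrib]
      refine Finset.dvd_sum fun a _ => ?_
      rw [← sub_mul]
      exact Dvd.dvd.mul_right (Int.dvd_self_sub_emod) _
    have he : x - m'.sum = x - (m'.sum + t.sum) + t.sum := by ring
    rw [he]
    exact dvd_add hd ht

/-- No integer misses both `P(A)` and `b * N - P(b - A)`, and `P(A)` contains everything above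
`b * N`, while `b * N - P(b - A)` contains everything below `0`. -/
theorem exists_mem_PA1_or {A : Finset ℤ} {b : ℤ} (hb : 0 < b) (h0 : 0 ∈ A) (hbA : b ∈ A)
    (hA : ∀ a ∈ A, 0 ≤ a ∧ a ≤ b) (hgcd : A.gcd id = 1) {N : ℕ} (hN : b - 1 ≤ N) (x : ℤ) :
    (x ∈ PA1 ↑A ∧ 0 ≤ x) ∨ (b * N - x ∈ PA1 ↑(A.image fun a => b - a) ∧ x ≤ b * N) := by
  obtain ⟨m, hm, hcard, j, hj⟩ := exists_sum_modEq hb hgcd x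
  have hs := sum_nonneg_and_le fun a ha => hA a (hm a ha)
  have hmN : b * m.card ≤ b * N := by gcongr; omega
  rcases le_or_gt 0 j with hj0 | hj0
  · left
    have : 0 ≤ b * j := by positivity
    refine ⟨(mem_PA1_iff (by simpa using h0)).2
      ⟨m + Multiset.replicate j.toNat b, ?_, ?_⟩, by linarith⟩
    · intro a ha
      rcases Multiset.mem_add.1 ha with ha | ha
      · exact hm a ha
      · rwa [Multiset.eq_of_mem_replicate ha]
    · rw [Multiset.sum_add, Multiset.sum_replicate, nsmul_eq_mul, Int.toNat_of_nonneg hj0]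
      linarith
  · right
    have : b * j ≤ 0 := by nlinarith
    refine ⟨(mem_PA1_sub_iff hbA).2
      ⟨m + Multiset.replicate (N - m.card - j).toNat 0, ?_, ?_⟩, by linarith⟩
    · intro a ha
      rcases Multiset.mem_add.1 ha with ha | ha
      · exact hm a ha
      · rwa [Multiset.eq_of_mem_replicate ha]
    · rw [Multiset.card_add, Multiset.card_replicate, Multiset.sum_add, Multiset.sum_replicate]
      push_cast
      rw [Int.toNat_of_nonneg (by omega)]
      simp only [smul_zero]
      linear_combination hj

/-- One-dimensional bound: with `min A = 0`, `max A = b`, `gcd A = 1`, `|A| ≥ 3`, for all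
`N ≥ b - 1` the structure equation holds and `|NA|` agrees with a polynomial. -/
theorem one_dimensional_bounds (A : Finset ℤ) (hne : A.Nonempty) (h3 : 3 ≤ A.card)
    (hmin : A.min' hne = 0) (b : ℤ) (hmax : A.max' hne = b) (hgcd : A.gcd id = 1) :
    (∀ N : ℕ, b - 1 ≤ (N : ℤ) →
      nfold1 ↑A N =
        Set.Icc (0 : ℤ) (b * N) \
          (E1 ↑A ∪ (({b * (N : ℤ)} : Set ℤ) - E1 ↑(A.image fun x => b - x)))) ∧
    ∃ P : Polynomial ℚ, ∀ N : ℕ, b - 1 ≤ (N : ℤ) →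
      ((nfold1 ↑A N).ncard : ℚ) = P.eval (N : ℚ) := by
  have h0 : 0 ∈ A := hmin ▸ A.min'_mem hne
  have hbA : b ∈ A := hmax ▸ A.max'_mem hne
  have hA : ∀ a ∈ A, 0 ≤ a ∧ a ≤ b := fun a ha =>
    ⟨hmin ▸ A.min'_le a ha, hmax ▸ A.le_max' a ha⟩
  have hb2 : 2 ≤ b := by
    have hsub : A ⊆ Finset.Icc 0 b := fun a ha => Finset.mem_Icc.2 (hA a ha)
    have := h3.trans (Finset.card_le_card hsub)
    simp at this
    omega
  have hb : 0 < b := by omega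
  have h0' : (0 : ℤ) ∈ (A : Set ℤ) := by simpa using h0
  set B : Set ℤ := ↑(A.image fun x => b - x) with hB
  have hstr : ∀ N : ℕ, b - 1 ≤ (N : ℤ) → nfold1 ↑A N =
      Set.Icc (0 : ℤ) (b * N) \ (E1 ↑A ∪ (({b * (N : ℤ)} : Set ℤ) - E1 B)) := by
    intro N hN
    ext x
    simp only [Set.mem_sdiff, Set.mem_Icc, Set.mem_union, not_or, Set.singleton_sub,
      Set.mem_image, not_exists, not_and]
    constructor
    · rw [mem_nfold1_iff]
      rintro ⟨m, hm, hmA, rfl⟩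
      have hs := sum_nonneg_and_le fun a ha => hA a (hmA a ha)
      rw [hm] at hs
      refine ⟨hs, fun h => h.2 ((mem_PA1_iff h0').2 ⟨m, hmA, rfl⟩), fun y hy he => hy.2 ?_⟩
      exact (mem_PA1_sub_iff hbA).2 ⟨m, hmA, by rw [hm]; linarith⟩
    · rintro ⟨⟨hx0, hx1⟩, hE, hE'⟩
      have hP : x ∈ PA1 ↑A := by
        by_contra h
        exact hE ⟨hx0, h⟩
      have hP' : b * N - x ∈ PA1 B := by
        by_contra h
        exact hE' (b * N - x) ⟨by linarith, h⟩ (by ring)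
      obtain ⟨U, hU, hUx⟩ := (mem_PA1_iff h0').1 hP
      obtain ⟨S, hS, hSx⟩ := (mem_PA1_sub_iff hbA).1 hP'
      exact mem_nfold1_iff.2 (exists_card_eq_sum_eq hb h0 hbA hA hN hU hS hUx hSx)
  refine ⟨hstr, Polynomial.C (b : ℚ) * Polynomial.X +
    Polynomial.C (1 - ((E1 ↑A).ncard : ℚ) - ((E1 B).ncard : ℚ)), fun N hN => ?_⟩
  have hdich := exists_mem_PA1_or hb h0 hbA hA hgcd hN
  have hE : E1 ↑A ⊆ Set.Icc (0 : ℤ) (b * N) := fun x hx =>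
    ⟨hx.1, ((hdich x).resolve_left fun h => hx.2 h.1).2⟩
  have hE' : (({b * (N : ℤ)} : Set ℤ) - E1 B) ⊆ Set.Icc (0 : ℤ) (b * N) := by
    rw [Set.singleton_sub]
    rintro _ ⟨y, hy, rfl⟩
    refine ⟨((hdich (b * N - y)).resolve_right fun h => hy.2 ?_).2, by linarith [hy.1]⟩
    simpa only [sub_sub_cancel] using h.1
  have hdisj : Disjoint (E1 ↑A) (({b * (N : ℤ)} : Set ℤ) - E1 B) := by
    rw [Set.disjoint_left, Set.singleton_sub]
    rintro _ hx ⟨y, hy, rfl⟩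
    rcases hdich (b * N - y) with h | h
    · exact hx.2 h.1
    · exact hy.2 (by simpa only [sub_sub_cancel] using h.1)
  have hfin := Set.finite_Icc (0 : ℤ) (b * N)
  have hcard := Set.ncard_sdiff_add_ncard_of_subset (Set.union_subset hE hE') hfin
  rw [← hstr N hN, Set.ncard_union_eq hdisj (hfin.subset hE) (hfin.subset hE'),
    Set.singleton_sub, Set.ncard_image_of_injective _ sub_right_injective] at hcard
  have hIcc : ((Set.Icc (0 : ℤ) (b * N)).ncard : ℤ) = b * N + 1 := by
    have : 0 ≤ b * N := by positivity
    rw [← Finset.coe_Icc, Set.ncard_coe_finset, Int.card_Icc, Int.toNat_of_nonneg (by omega)]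
    ring
  rw [← hcard] at hIcc
  have hq := congrArg (Int.cast : ℤ → ℚ) hIcc
  push_cast at hq
  simp only [Polynomial.eval_add, Polynomial.eval_mul, Polynomial.eval_C, Polynomial.eval_X]
  linarith
end
end

section
/- Let B ∪ {0} ⊂ A ⊂ ℤ^d with A finite, |A| = ℓ, B a nonempty linearly independent set, and 0 ∈ ex(H(A)). Let A^+ be the set of x ∈ P(A) ∩ C_B such that for all b ∈ B, x − b ∉ P(A) ∩ C_B. Then C_B ∩ P(A) = A^+ + P(B ∪ {0}), and A^+ ⊆ N·A for some positive integer N ≤ 2^{11 d^2} d^{12 d^6} ℓ^{3 d^2} w(A)^{8 d^6}. -/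
open Pointwise MeasureTheory

noncomputable section

open Matrix in
attribute [local instance] Matrix.seminormedAddCommGroup in
/-- Siegel's lemma, with an integral bound that does not involve division in the exponent. -/
theorem exists_int_ker_le {α β : Type*} [Fintype α] [Fintype β] (M : Matrix α β ℤ) {W : ℕ}
    (hW : 1 ≤ W) (hM : ∀ i j, |M i j| ≤ (W : ℤ)) (hlt : Fintype.card α < Fintype.card β) :
    ∃ t : β → ℤ, t ≠ 0 ∧ M *ᵥ t = 0 ∧
      ∀ j, |t j| ≤ ((Fintype.card β * W) ^ Fintype.card α : ℕ) := by
  classical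
  rcases Nat.eq_zero_or_pos (Fintype.card α) with h0 | hpos
  · have : IsEmpty α := Fintype.card_eq_zero_iff.mp h0
    have : Nonempty β := Fintype.card_pos_iff.mp (by omega)
    refine ⟨1, one_ne_zero, Subsingleton.elim _ _, fun j => ?_⟩
    simp
  · obtain ⟨t, ht0, hMt, ht⟩ := Int.Matrix.exists_ne_zero_int_vec_norm_le M hlt hpos
    refine ⟨t, ht0, hMt, fun j => ?_⟩
    have hnorm : max 1 ‖M‖ ≤ (W : ℝ) := by
      refine max_le (by exact_mod_cast hW) ?_
      refine (Matrix.norm_le_iff (by positivity)).mpr fun i j => ?_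
      rw [Int.norm_eq_abs]
      exact_mod_cast hM i j
    have hb : (1 : ℝ) ≤ Fintype.card β := by exact_mod_cast (by omega : 1 ≤ Fintype.card β)
    have hW' : (1 : ℝ) ≤ W := by exact_mod_cast hW
    have hsub : (1 : ℝ) ≤ (Fintype.card β : ℝ) - Fintype.card α := by
      have : ((Fintype.card α + 1 : ℕ) : ℝ) ≤ Fintype.card β := by exact_mod_cast hlt
      push_cast at this
      linarith
    have key : ‖t‖ ≤ ((Fintype.card β : ℝ) * W) ^ (Fintype.card α : ℝ) := by
      refine ht.trans ?_
      calc ((Fintype.card β : ℝ) * max 1 ‖M‖) ^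
              ((Fintype.card α : ℝ) / (Fintype.card β - Fintype.card α))
          ≤ ((Fintype.card β : ℝ) * W) ^
              ((Fintype.card α : ℝ) / (Fintype.card β - Fintype.card α)) := by
            gcongr
        _ ≤ _ := Real.rpow_le_rpow_of_exponent_le (by nlinarith)
            (div_le_self (by positivity) hsub)
    have h1 := (norm_le_pi_norm t j).trans key
    rw [Real.rpow_natCast, Int.norm_eq_abs] at h1
    exact_mod_cast h1

/-- A matrix whose kernel contains a nonzero real vector `y` has a nonzero integral vector of
bounded size in its kernel, supported inside the support of `y`. -/
theorem exists_int_ker_support_le {κ ι : Type*} [Fintype κ] [Fintype ι] (M : Matrix κ ι ℤ) {W : ℕ}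
    (hW : 1 ≤ W) (hM : ∀ i j, |M i j| ≤ (W : ℤ)) {y : ι → ℝ} (hy0 : y ≠ 0)
    (hy : ∀ k, ∑ i, (M k i : ℝ) * y i = 0) :
    ∃ z : ι → ℤ, z ≠ 0 ∧ (∀ k, ∑ i, (M k i : ℝ) * z i = 0) ∧ (∀ i, y i = 0 → z i = 0) ∧
      ∀ i, |z i| ≤ ((Fintype.card ι * W) ^ Fintype.card κ : ℕ) := by
  classical
  let S := {i // y i ≠ 0}
  have hsum : ∀ f : ι → ℝ, (∀ i, y i = 0 → f i = 0) → ∑ i, f i = ∑ i : S, f i := by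
    intro f hf
    rw [← Finset.sum_subtype (Finset.univ.filter (y · ≠ 0)) (by simp) f]
    exact (Finset.sum_filter_of_ne (p := (y · ≠ 0)) fun i _ hi h => hi (hf i h)).symm
  let r : κ → S → ℝ := fun k i => M k i
  obtain ⟨κ', a, ha, hspan, hli⟩ := exists_linearIndependent' ℝ r
  have : Fintype κ' := Fintype.ofInjective a ha
  let dot : (S → ℝ) → (S → ℝ) →ₗ[ℝ] ℝ := fun u => Fintype.linearCombination ℝ u
  have hdot : ∀ u w, dot u w = ∑ i, w i * u i := fun u w => by
    simp [dot, Fintype.linearCombination_apply]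
  have hker : ∀ u : S → ℝ, (∀ k', dot u (r (a k')) = 0) →
      Submodule.span ℝ (Set.range r) ≤ LinearMap.ker (dot u) := by
    intro u hu
    rw [← hspan, Submodule.span_le]
    rintro _ ⟨k', rfl⟩
    exact hu k'
  have hcard : Fintype.card κ' < Fintype.card S := by
    rw [← finrank_span_eq_card hli, ← Module.finrank_fintype_fun_eq_card ℝ (η := S)]
    refine Submodule.finrank_lt fun htop => ?_
    obtain ⟨i, hi⟩ := Function.ne_iff.mp hy0
    have h1 := hker (fun i => y i) fun k' => by
      rw [hdot]
      exact (hsum (fun i => (M (a k') i : ℝ) * y i) fun i hi => by simp [hi]).symm.trans (hy _)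
    rw [← hspan, htop] at h1
    replace hi : y i ≠ 0 := hi
    have h2 : dot (fun i => y i) (Pi.single ⟨i, hi⟩ 1) = 0 := h1 Submodule.mem_top
    rw [hdot] at h2
    rw [Fintype.sum_eq_single ⟨i, hi⟩ fun j hj => by simp [hj]] at h2
    exact hi (by simpa using h2)
  obtain ⟨t, ht0, hMt, ht⟩ := exists_int_ker_le (Matrix.of fun k' (i : S) => M (a k') i) hW
    (fun _ _ => hM _ _) hcard
  have hext : ∀ i : S, (if h : y i ≠ 0 then t ⟨i, h⟩ else 0) = t i := fun i => dif_pos i.2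
  refine ⟨fun i => if h : y i ≠ 0 then t ⟨i, h⟩ else 0, ?_, fun k => ?_, ?_, fun i => ?_⟩
  · obtain ⟨i, hi⟩ := Function.ne_iff.mp ht0
    refine Function.ne_iff.mpr ⟨i, ?_⟩
    rw [hext]
    exact hi
  · rw [hsum _ fun i hi => by simp [hi]]
    simp only [hext]
    have h1 := hker (fun i => (t i : ℝ)) fun k' => by
      rw [hdot]
      have := congrFun hMt k'
      simp only [Matrix.mulVec, dotProduct, Matrix.of_apply, Pi.zero_apply] at this
      simp only [r]
      exact_mod_cast this
    have h2 := h1 (Submodule.subset_span ⟨k, rfl⟩)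
    rwa [LinearMap.mem_ker, hdot] at h2
  · intro i hi
    simp [hi]
  · have hι : Fintype.card S ≤ Fintype.card ι := Fintype.card_subtype_le _
    have hκ : Fintype.card κ' ≤ Fintype.card κ := Fintype.card_le_of_injective a ha
    have hpos : 1 ≤ Fintype.card ι * W := Nat.mul_pos (by omega) hW
    by_cases h : y i ≠ 0
    · simp only [dif_pos h]
      refine (ht _).trans ?_
      exact_mod_cast (Nat.pow_le_pow_left (Nat.mul_le_mul_right W hι) _).trans
        (Nat.pow_le_pow_right hpos hκ)
    · simp only [dif_neg h, abs_zero]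
      positivity

/-- A nonzero vector in the kernel of an integral matrix that lies in the nonnegative orthant
supports a nonzero integral one of bounded size. -/
theorem exists_nat_ker_support_le {κ ι : Type*} [Fintype κ] [Fintype ι] (M : Matrix κ ι ℤ) {W : ℕ}
    (hW : 1 ≤ W) (hM : ∀ i j, |M i j| ≤ (W : ℤ)) {y : ι → ℝ} (hy0 : y ≠ 0) (hnn : ∀ i, 0 ≤ y i)
    (hy : ∀ k, ∑ i, (M k i : ℝ) * y i = 0) :
    ∃ g : ι → ℕ, g ≠ 0 ∧ (∀ k, ∑ i, (M k i : ℝ) * g i = 0) ∧ (∀ i, y i = 0 → g i = 0) ∧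
      ∀ i, g i ≤ (Fintype.card ι * W) ^ Fintype.card κ := by
  classical
  induction hn : (Finset.univ.filter (y · ≠ 0)).card using Nat.strong_induction_on
    generalizing y with
  | _ n ih =>
    obtain ⟨z, hz0, hMz, hzs, hzb, i₁, hi₁⟩ : ∃ z : ι → ℤ, z ≠ 0 ∧
        (∀ k, ∑ i, (M k i : ℝ) * z i = 0) ∧ (∀ i, y i = 0 → z i = 0) ∧
        (∀ i, |z i| ≤ ((Fintype.card ι * W) ^ Fintype.card κ : ℕ)) ∧ ∃ i, 0 < z i := by
      obtain ⟨z, hz0, hMz, hzs, hzb⟩ := exists_int_ker_support_le M hW hM hy0 hy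
      obtain ⟨i, hi⟩ := Function.ne_iff.mp hz0
      rcases lt_or_gt_of_ne hi with h | h
      · refine ⟨-z, neg_ne_zero.mpr hz0, fun k => ?_, fun i hi => by simp [hzs i hi],
          fun i => by simpa using hzb i, i, by simpa using h⟩
        simpa using hMz k
      · exact ⟨z, hz0, hMz, hzs, hzb, i, h⟩
    obtain ⟨i₀, hi₀, hmin⟩ := Finset.exists_min_image (Finset.univ.filter (0 < z ·))
      (fun i => y i / z i) ⟨i₁, by simpa using hi₁⟩
    simp only [Finset.mem_filter, Finset.mem_univ, true_and] at hi₀ hmin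
    have hzi₀ : (0 : ℝ) < z i₀ := by exact_mod_cast hi₀
    set t : ℝ := y i₀ / z i₀ with ht
    have hyi₀ : 0 < y i₀ := (hnn i₀).lt_of_ne fun h => by
      have := hzs i₀ h.symm
      omega
    have htpos : 0 < t := div_pos hyi₀ hzi₀
    have hynn : ∀ i, 0 ≤ y i - t * z i := fun i => by
      rcases lt_or_ge 0 (z i) with h | h
      · have h' : (0 : ℝ) < z i := by exact_mod_cast h
        have := (le_div_iff₀ h').mp (hmin i h)
        linarith
      · have h' : (z i : ℝ) ≤ 0 := by exact_mod_cast h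
        nlinarith [hnn i]
    have hMy : ∀ k, ∑ i, (M k i : ℝ) * (y i - t * z i) = 0 := fun k => by
      have : ∀ i, (M k i : ℝ) * (y i - t * z i) = M k i * y i - t * (M k i * z i) :=
        fun i => by ring
      simp only [this, Finset.sum_sub_distrib, ← Finset.mul_sum, hy, hMz, mul_zero, sub_zero]
    by_cases hzero : (fun i => y i - t * z i) = 0
    · have hznn : ∀ i, 0 ≤ z i := fun i => by
        have h1 := congrFun hzero i
        simp only [Pi.zero_apply] at h1
        have h2 : 0 ≤ t * z i := by linarith [hnn i]
        exact_mod_cast (mul_nonneg_iff_of_pos_left htpos).mp h2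
      have hcast : ∀ i, ((z i).toNat : ℤ) = z i := fun i => Int.toNat_of_nonneg (hznn i)
      refine ⟨fun i => (z i).toNat, fun h => ?_, fun k => ?_, fun i hi => by simp [hzs i hi],
        fun i => ?_⟩
      · have := congrFun h i₀
        simp only [Pi.zero_apply] at this
        omega
      · rw [← hMz k]
        refine Finset.sum_congr rfl fun i _ => ?_
        congr 1
        exact_mod_cast hcast i
      · have := (le_abs_self _).trans (hzb i)
        rw [← hcast i] at this
        exact_mod_cast this
    · have hsub : ∀ i, y i = 0 → y i - t * z i = 0 := fun i hi => by simp [hi, hzs i hi]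
      obtain ⟨g, hg0, hMg, hgs, hgb⟩ := ih _ (by
        rw [← hn]
        refine Finset.card_lt_card ⟨fun i => ?_, fun h => ?_⟩
        · simp only [Finset.mem_filter, Finset.mem_univ, true_and]
          exact fun h h' => h (hsub i h')
        · have := h (by simpa using hyi₀.ne' : i₀ ∈ _)
          simp only [Finset.mem_filter, Finset.mem_univ, true_and] at this
          exact this (by rw [ht]; field_simp; simp)) hzero hynn hMy rfl
      exact ⟨g, hg0, hMg, fun i hi => hgs i (hsub i hi), hgb⟩

/-- A nonnegative kernel vector that dominates no nonzero integral kernel vector is bounded. -/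
theorem le_of_forall_nat_ker_not_le {κ ι : Type*} [Fintype κ] [Fintype ι] (M : Matrix κ ι ℤ)
    {W : ℕ} (hW : 1 ≤ W) (hM : ∀ i j, |M i j| ≤ (W : ℤ)) {y : ι → ℝ} (hnn : ∀ i, 0 ≤ y i)
    (hy : ∀ k, ∑ i, (M k i : ℝ) * y i = 0)
    (hirr : ∀ g : ι → ℕ, g ≠ 0 → (∀ k, ∑ i, (M k i : ℝ) * g i = 0) → ¬ ∀ i, (g i : ℝ) ≤ y i)
    (i : ι) :
    y i ≤ (Fintype.card ι * (Fintype.card ι * W) ^ Fintype.card κ : ℕ) := by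
  classical
  have key : ∀ n, ∀ y : ι → ℝ, (∀ i, 0 ≤ y i) → (∀ k, ∑ i, (M k i : ℝ) * y i = 0) →
      (∀ g : ι → ℕ, g ≠ 0 → (∀ k, ∑ i, (M k i : ℝ) * g i = 0) → ¬ ∀ i, (g i : ℝ) ≤ y i) →
      (Finset.univ.filter (y · ≠ 0)).card ≤ n →
      ∀ i, y i ≤ (n * (Fintype.card ι * W) ^ Fintype.card κ : ℕ) := by
    intro n
    induction n with
    | zero =>
      intro y _ _ _ hn i
      rw [Nat.le_zero, Finset.card_eq_zero, Finset.filter_eq_empty_iff] at hn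
      simp [not_not.mp (hn (Finset.mem_univ i))]
    | succ n ih =>
      intro y hnn hy hirr hn i
      by_cases hy0 : y = 0
      · simp only [hy0, Pi.zero_apply]
        positivity
      obtain ⟨g, hg0, hMg, hgs, hgb⟩ := exists_nat_ker_support_le M hW hM hy0 hnn hy
      obtain ⟨i₁, hi₁⟩ := Function.ne_iff.mp hg0
      obtain ⟨i₀, hi₀, hmin⟩ := Finset.exists_min_image (Finset.univ.filter (0 < g ·))
        (fun i => y i / g i) ⟨i₁, by simpa using Nat.pos_of_ne_zero hi₁⟩
      simp only [Finset.mem_filter, Finset.mem_univ, true_and] at hi₀ hmin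
      have hgi₀ : (0 : ℝ) < g i₀ := by exact_mod_cast hi₀
      set t : ℝ := y i₀ / g i₀ with ht
      have hyi₀ : y i₀ ≠ 0 := fun h => hi₀.ne' (hgs i₀ h)
      have htnn : 0 ≤ t := div_nonneg (hnn i₀) hgi₀.le
      have htg : ∀ i, t * g i ≤ y i := fun i => by
        rcases Nat.eq_zero_or_pos (g i) with h | h
        · simpa [h] using hnn i
        · exact (le_div_iff₀ (by exact_mod_cast h)).mp (hmin i h)
      have ht1 : t ≤ 1 := by
        by_contra! h
        exact hirr g hg0 hMg fun i => (htg i).trans' (le_mul_of_one_le_left (by positivity) h.le)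
      have := ih (fun i => y i - t * g i) (fun i => sub_nonneg.mpr (htg i)) (fun k => by
          have : ∀ i, (M k i : ℝ) * (y i - t * g i) = M k i * y i - t * (M k i * g i) :=
            fun i => by ring
          simp only [this, Finset.sum_sub_distrib, ← Finset.mul_sum, hy, hMg, mul_zero, sub_zero])
        (fun g' hg' hMg' h => hirr g' hg' hMg' fun i =>
          (h i).trans (sub_le_self _ (by positivity)))
        (by
          refine Nat.le_of_lt_succ (lt_of_lt_of_le (Finset.card_lt_card ⟨fun i => ?_, fun h => ?_⟩)
            hn)
          · simp only [Finset.mem_filter, Finset.mem_univ, true_and]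
            exact fun h h' => h (by simp [h', hgs i h'])
          · have := h (by simpa using hyi₀ : i₀ ∈ _)
            simp only [Finset.mem_filter, Finset.mem_univ, true_and] at this
            exact this (by rw [ht]; field_simp; simp)) i
      have hg : t * g i ≤ ((Fintype.card ι * W) ^ Fintype.card κ : ℕ) :=
        (mul_le_of_le_one_left (by positivity) ht1).trans (by exact_mod_cast hgb i)
      push_cast at this hg ⊢
      linarith
  exact key _ y hnn hy hirr (Finset.card_le_univ _) i

theorem nfold_add {d : ℕ} {S : Set (Fin d → ℤ)} {m n : ℕ} {x y : Fin d → ℤ}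
    (hx : x ∈ nfold d S m) (hy : y ∈ nfold d S n) : x + y ∈ nfold d S (m + n) := by
  obtain ⟨f, hf, rfl⟩ := hx
  obtain ⟨g, hg, rfl⟩ := hy
  refine ⟨Fin.append f g, fun i => ?_, by simp [Fin.sum_univ_add]⟩
  induction i using Fin.addCases with
  | left i => simpa using hf i
  | right i => simpa using hg i

theorem nsmul_mem_nfold {d : ℕ} {S : Set (Fin d → ℤ)} {a : Fin d → ℤ} (ha : a ∈ S) (n : ℕ) :
    n • a ∈ nfold d S n :=
  ⟨fun _ => a, fun _ => ha, by simp⟩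

theorem sum_nsmul_mem_nfold {d : ℕ} {S : Set (Fin d → ℤ)} {ι : Type*} (s : Finset ι)
    {f : ι → Fin d → ℤ} (hf : ∀ i, f i ∈ S) (m : ι → ℕ) :
    ∑ i ∈ s, m i • f i ∈ nfold d S (∑ i ∈ s, m i) := by
  classical
  induction s using Finset.induction_on with
  | empty => exact ⟨Fin.elim0, fun i => i.elim0, (Fin.sum_univ_zero _).symm⟩
  | insert i s hi ih =>
    rw [Finset.sum_insert hi, Finset.sum_insert hi]
    exact nfold_add (nsmul_mem_nfold (hf i) _) ih

theorem nfold_mono {d : ℕ} {S : Set (Fin d → ℤ)} (h0 : 0 ∈ S) {m n : ℕ} (hmn : m ≤ n) :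
    nfold d S m ⊆ nfold d S n := by
  intro x hx
  obtain ⟨k, rfl⟩ := Nat.exists_eq_add_of_le hmn
  simpa using nfold_add hx (nsmul_mem_nfold h0 k)

theorem PA_eq_closure {d : ℕ} {S : Set (Fin d → ℤ)} (h0 : 0 ∈ S) :
    PA d S = (AddSubmonoid.closure S : Set (Fin d → ℤ)) := by
  ext x
  simp only [PA, Set.mem_iUnion, Set.mem_Ici, exists_prop, SetLike.mem_coe]
  constructor
  · rintro ⟨N, -, f, hf, rfl⟩
    exact sum_mem fun i _ => AddSubmonoid.subset_closure (hf i)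
  · intro hx
    induction hx using AddSubmonoid.closure_induction with
    | mem x hx => exact ⟨1, le_rfl, by simpa using nsmul_mem_nfold hx 1⟩
    | zero => exact ⟨1, le_rfl, by simpa using nsmul_mem_nfold h0 1⟩
    | add x y _ _ hx hy =>
      obtain ⟨m, hm, hx⟩ := hx
      obtain ⟨n, hn, hy⟩ := hy
      exact ⟨m + n, by omega, nfold_add hx hy⟩

theorem emb_add (d : ℕ) (x y : Fin d → ℤ) : emb d (x + y) = emb d x + emb d y := by
  ext i
  simp [emb]

theorem emb_sub (d : ℕ) (x y : Fin d → ℤ) : emb d (x - y) = emb d x - emb d y := by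
  ext i
  simp [emb]

theorem emb_zero (d : ℕ) : emb d 0 = 0 := by
  ext i
  simp [emb]

theorem emb_injective (d : ℕ) : Function.Injective (emb d) := fun x y h => by
  ext i
  exact Int.cast_injective (congrFun h i)

theorem add_mem_cone {d : ℕ} {B : Finset (Fin d → ℤ)} {x y : Fin d → ℝ} (hx : x ∈ cone d B)
    (hy : y ∈ cone d B) : x + y ∈ cone d B := by
  obtain ⟨c, hc, rfl⟩ := hx
  obtain ⟨e, he, rfl⟩ := hy
  exact ⟨c + e, fun a => add_nonneg (hc a) (he a), by
    simp [add_smul, Finset.sum_add_distrib]⟩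

theorem emb_mem_cone_of_mem {d : ℕ} {B : Finset (Fin d → ℤ)} {b : Fin d → ℤ} (hb : b ∈ B) :
    emb d b ∈ cone d B := by
  classical
  exact ⟨fun a => if a = b then 1 else 0, fun a => by positivity, by simp [hb]⟩

theorem emb_mem_cone_of_mem_closure {d : ℕ} {B : Finset (Fin d → ℤ)} {x : Fin d → ℤ}
    (hx : x ∈ AddSubmonoid.closure ((B : Set (Fin d → ℤ)) ∪ {0})) : emb d x ∈ cone d B := by
  have hzero : emb d 0 ∈ cone d B := ⟨0, fun _ => le_rfl, by simp [emb_zero]⟩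
  induction hx using AddSubmonoid.closure_induction with
  | mem x hx =>
    rcases hx with hx | rfl
    · exact emb_mem_cone_of_mem hx
    · exact hzero
  | zero => exact hzero
  | add x y _ _ hx hy =>
    rw [emb_add]
    exact add_mem_cone hx hy

theorem abs_le_width {d : ℕ} {A : Finset (Fin d → ℤ)} (h0 : 0 ∈ A) {a : Fin d → ℤ} (ha : a ∈ A)
    (i : Fin d) : |a i| ≤ width d A := by
  have h1 : ((a - 0) i).natAbs ≤ width d A :=
    (Finset.le_sup (f := fun i => (a i - (0 : Fin d → ℤ) i).natAbs) (Finset.mem_univ i)).trans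
      (Finset.le_sup (f := fun p : (Fin d → ℤ) × (Fin d → ℤ) =>
        Finset.univ.sup fun i => (p.1 i - p.2 i).natAbs) (Finset.mk_mem_product ha h0))
  rw [sub_zero] at h1
  rw [Int.abs_eq_natAbs]
  exact_mod_cast h1

/-- If `0` is an extreme point of `H(A)`, some linear form is positive on `A ∖ {0}`. -/
theorem exists_pos_of_zero_mem_exP {d : ℕ} {A : Finset (Fin d → ℤ)} (h0 : 0 ∈ exP d A) :
    ∃ v : (Fin d → ℤ) →+ ℝ, ∀ a ∈ A, a ≠ 0 → 0 < v a := by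
  obtain ⟨-, v, -, -, hv⟩ := h0
  refine ⟨⟨⟨fun x => ∑ i, v i * x i, by simp⟩, fun x y => by
    simp [mul_add, Finset.sum_add_distrib]⟩, fun a ha ha0 => ?_⟩
  simpa [emb] using hv (emb d a) (subset_convexHull ℝ _ ⟨a, ha, rfl⟩)
    fun h => ha0 (emb_injective d h)

theorem zero_notMem_of_linearIndependent {d : ℕ} {B : Finset (Fin d → ℤ)}
    (hli : LinearIndependent ℝ (fun x : {x // x ∈ B} => emb d x.1)) : 0 ∉ B :=
  fun h => hli.ne_zero ⟨0, h⟩ (emb_zero d)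

/-- Subtracting elements of `B` as long as possible terminates. -/
theorem exists_minimal_add {G : Type*} [AddCommGroup G] (B : Finset G) (v : G →+ ℝ) (Q : Set G)
    (hvB : ∀ b ∈ B, 0 < v b) (hvQ : ∀ x ∈ Q, 0 ≤ v x) {x : G} (hx : x ∈ Q) :
    ∃ y ∈ Q, (∀ b ∈ B, y - b ∉ Q) ∧ ∃ p ∈ AddSubmonoid.closure (B : Set G), x = y + p := by
  obtain ⟨ε, hε, hεB⟩ : ∃ ε > 0, ∀ b ∈ B, ε ≤ v b := by
    rcases B.eq_empty_or_nonempty with rfl | hne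
    · exact ⟨1, one_pos, by simp⟩
    · obtain ⟨b, hb, hmin⟩ := B.exists_min_image v hne
      exact ⟨v b, hvB b hb, hmin⟩
  obtain ⟨n, hn⟩ := exists_nat_gt (v x / ε)
  rw [div_lt_iff₀ hε] at hn
  induction n generalizing x with
  | zero =>
    have := hvQ x hx
    simp only [Nat.cast_zero, zero_mul] at hn
    linarith
  | succ n ih =>
    by_cases h : ∀ b ∈ B, x - b ∉ Q
    · exact ⟨x, hx, h, 0, zero_mem _, (add_zero x).symm⟩
    · push Not at h
      obtain ⟨b, hb, hxb⟩ := h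
      obtain ⟨y, hy, hymin, p, hp, hxp⟩ := ih hxb (by
        rw [map_sub]
        push_cast at hn
        linarith [hεB b hb])
      exact ⟨y, hy, hymin, p + b, add_mem hp (AddSubmonoid.subset_closure hb), by
        rw [← add_assoc, ← hxp, sub_add_cancel]⟩

/-- The multiplicities in any representation of a minimal element by nonzero elements of `A` are
bounded. -/
theorem multiplicity_le_of_minimal {d : ℕ} {A B : Finset (Fin d → ℤ)} (h0A : 0 ∈ A) (hBA : B ⊆ A)
    {v : (Fin d → ℤ) →+ ℝ} (hv : ∀ a ∈ A, a ≠ 0 → 0 < v a) (hW : 1 ≤ width d A)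
    {m : {a // a ∈ A.erase 0} → ℕ} {x : Fin d → ℤ} (hx : x = ∑ a, m a • a.1)
    (hxB : emb d x ∈ cone d B)
    (hmin : ∀ b ∈ B, ¬(x - b ∈ AddSubmonoid.closure (A : Set (Fin d → ℤ)) ∧
      emb d (x - b) ∈ cone d B)) (a : {a // a ∈ A.erase 0}) :
    m a ≤ 2 * A.card * (2 * A.card * width d A) ^ d := by
  classical
  obtain ⟨c, hc, hxc⟩ := hxB
  let M : Matrix (Fin d) ({a // a ∈ A.erase 0} ⊕ {b // b ∈ B}) ℤ :=
    fun k => Sum.elim (fun a => a.1 k) (fun b => -b.1 k)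
  have hAmem : ∀ a : {a // a ∈ A.erase 0}, a.1 ∈ A := fun a => Finset.mem_of_mem_erase a.2
  have hM : ∀ k i, |M k i| ≤ width d A := by
    rintro k (a | b)
    · exact abs_le_width h0A (hAmem a) k
    · simpa [M] using abs_le_width h0A (hBA b.2) k
  have hbound := le_of_forall_nat_ker_not_le M hW hM
    (y := Sum.elim (fun a => (m a : ℝ)) (fun b => c b)) (by
      rintro (a | b)
      · simp
      · exact hc b) (fun k => by
      have h1 := congrFun hxc k
      rw [← Finset.sum_coe_sort B] at h1
      simp only [emb, hx, Finset.sum_apply, Pi.smul_apply, smul_eq_mul] at h1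
      push_cast [nsmul_eq_mul] at h1
      simp only [Fintype.sum_sum_type, M, Sum.elim_inl, Sum.elim_inr]
      push_cast
      simp only [neg_mul, Finset.sum_neg_distrib]
      simp only [mul_comm (Int.cast _ : ℝ)]
      rw [h1]
      exact add_neg_cancel _) (fun g hg0 hMg hle => by
      have hrel : ∑ a : {a // a ∈ A.erase 0}, g (.inl a) • a.1 =
          ∑ b : {b // b ∈ B}, g (.inr b) • b.1 := by
        ext k
        have h1 := hMg k
        simp only [Fintype.sum_sum_type, M, Sum.elim_inl, Sum.elim_inr] at h1
        push_cast at h1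
        simp only [neg_mul, Finset.sum_neg_distrib] at h1
        have h2 := add_neg_eq_zero.mp h1
        simp only [Finset.sum_apply, Pi.smul_apply]
        simp only [nsmul_eq_mul, mul_comm (Nat.cast _ : ℤ)]
        exact_mod_cast h2
      obtain ⟨b₀, hb₀⟩ : ∃ b, g (.inr b) ≠ 0 := by
        by_contra! h
        simp only [h, zero_smul, Finset.sum_const_zero] at hrel
        have h1 := congrArg v hrel
        simp only [map_sum, map_nsmul, map_zero] at h1
        simp only [nsmul_eq_mul] at h1
        have hpos : ∀ a : {a // a ∈ A.erase 0}, 0 < v a.1 :=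
          fun a => hv _ (hAmem a) (Finset.ne_of_mem_erase a.2)
        rw [Finset.sum_eq_zero_iff_of_nonneg
          fun a _ => mul_nonneg (by positivity) (hpos a).le] at h1
        refine hg0 (funext ?_)
        rintro (a | b)
        · simpa [(hpos a).ne'] using h1 a (Finset.mem_univ a)
        · exact h b
      have hgm : ∀ a, g (.inl a) ≤ m a := fun a => Nat.cast_le.mp (hle (.inl a))
      refine hmin b₀ b₀.2 ⟨?_, fun b => c b - if b = b₀ then 1 else 0, fun b => ?_, ?_⟩
      · have hsplit : x - b₀ = ∑ a, (m a - g (.inl a)) • a.1 +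
            ((g (.inr b₀) - 1) • b₀.1 + ∑ b ∈ Finset.univ.erase b₀, g (.inr b) • b.1) := by
          have h1 : ∑ a, (m a - g (.inl a)) • a.1 + ∑ a, g (.inl a) • a.1 = x := by
            rw [hx, ← Finset.sum_add_distrib]
            exact Finset.sum_congr rfl fun a _ => by rw [← add_nsmul, Nat.sub_add_cancel (hgm a)]
          have h2 : (g (.inr b₀) - 1) • b₀.1 + b₀.1 = g (.inr b₀) • b₀.1 := by
            rw [← succ_nsmul, Nat.sub_add_cancel (Nat.one_le_iff_ne_zero.mpr hb₀)]
          rw [hrel, ← Finset.add_sum_erase _ _ (Finset.mem_univ b₀), ← h2] at h1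
          rw [← h1]
          abel
        rw [hsplit]
        refine add_mem (sum_mem fun a _ => nsmul_mem (AddSubmonoid.subset_closure (hAmem a)) _)
          (add_mem (nsmul_mem (AddSubmonoid.subset_closure (hBA b₀.2)) _)
            (sum_mem fun b _ => nsmul_mem (AddSubmonoid.subset_closure (hBA b.2)) _))
      · dsimp only
        split_ifs with h
        · have h1 := hle (.inr b₀)
          have h2 : (1 : ℝ) ≤ g (.inr b₀) := by exact_mod_cast Nat.one_le_iff_ne_zero.mpr hb₀
          simp only [Sum.elim_inr] at h1
          rw [h]
          linarith
        · simpa using hc b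
      · simp [emb_sub, hxc, sub_smul, Finset.sum_sub_distrib]) (.inl a)
  have hcard : Fintype.card ({a // a ∈ A.erase 0} ⊕ {b // b ∈ B}) ≤ 2 * A.card := by
    rw [Fintype.card_sum, Fintype.card_coe, Fintype.card_coe]
    have h1 := Finset.card_le_card hBA
    have h2 := Finset.card_le_card (Finset.erase_subset 0 A)
    omega
  rw [Fintype.card_fin] at hbound
  refine (Nat.cast_le.mp hbound).trans ?_
  gcongr

/-- Decomposing `C_B ∩ P(A)` via `A⁺`, and `A⁺ ⊆ NA` for an explicitly bounded `N`. -/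
theorem decompose_PA_cone (d : ℕ) (A B : Finset (Fin d → ℤ)) (hB : B.Nonempty)
    (hBA : (B : Set (Fin d → ℤ)) ∪ {0} ⊆ (A : Set (Fin d → ℤ)))
    (hli : LinearIndependent ℝ (fun x : {x // x ∈ B} => emb d x.1))
    (h0 : (0 : Fin d → ℤ) ∈ exP d A) :
    {x | x ∈ PA d ↑A ∧ emb d x ∈ cone d B} =
      {x | x ∈ PA d ↑A ∧ emb d x ∈ cone d B ∧
          ∀ b ∈ B, ¬(x - b ∈ PA d ↑A ∧ emb d (x - b) ∈ cone d B)}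
        + PA d ((B : Set (Fin d → ℤ)) ∪ {0}) ∧
    ∃ N : ℕ, 0 < N ∧
      N ≤ 2 ^ (11 * d ^ 2) * d ^ (12 * d ^ 6) * A.card ^ (3 * d ^ 2)
            * width d A ^ (8 * d ^ 6) ∧
      {x | x ∈ PA d ↑A ∧ emb d x ∈ cone d B ∧
          ∀ b ∈ B, ¬(x - b ∈ PA d ↑A ∧ emb d (x - b) ∈ cone d B)} ⊆ nfold d ↑A N := by
  have h0A : (0 : Fin d → ℤ) ∈ (A : Set (Fin d → ℤ)) := hBA (Or.inr rfl)
  have hBA' : B ⊆ A := fun b hb => hBA (Or.inl hb)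
  have hB0 := zero_notMem_of_linearIndependent hli
  obtain ⟨v, hv⟩ := exists_pos_of_zero_mem_exP h0
  rw [PA_eq_closure h0A, PA_eq_closure (Set.mem_union_right _ (Set.mem_singleton 0))]
  simp only [SetLike.mem_coe]
  have hvnn : ∀ x ∈ AddSubmonoid.closure (A : Set (Fin d → ℤ)), 0 ≤ v x := fun x hx => by
    induction hx using AddSubmonoid.closure_induction with
    | mem a ha =>
      rcases eq_or_ne a 0 with rfl | h
      · simp
      · exact (hv a ha h).le
    | zero => simp
    | add x y _ _ hx hy =>
      rw [map_add]
      exact add_nonneg hx hy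
  constructor
  · ext x
    simp only [Set.mem_ofPred_eq, Set.mem_add, SetLike.mem_coe]
    constructor
    · intro hx
      obtain ⟨y, hy, hymin, p, hp, rfl⟩ := exists_minimal_add B v
        {x | x ∈ AddSubmonoid.closure (A : Set (Fin d → ℤ)) ∧ emb d x ∈ cone d B}
        (fun b hb => hv b (hBA' hb) fun h => hB0 (h ▸ hb))
        (fun x hx => hvnn x hx.1) hx
      exact ⟨y, ⟨hy.1, hy.2, hymin⟩, p, AddSubmonoid.closure_mono Set.subset_union_left hp, rfl⟩
    · rintro ⟨y, ⟨hyA, hyB, -⟩, p, hp, rfl⟩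
      refine ⟨add_mem hyA (AddSubmonoid.closure_mono hBA hp), ?_⟩
      rw [emb_add]
      exact add_mem_cone hyB (emb_mem_cone_of_mem_closure hp)
  · obtain ⟨b, hb⟩ := hB
    obtain ⟨i, hi⟩ : ∃ i, b i ≠ 0 := Function.ne_iff.mp (ne_of_mem_of_not_mem hb hB0)
    have hd : 1 ≤ d := i.pos
    have hW : 1 ≤ width d A := by
      have := abs_le_width h0A (hBA' hb) i
      have := abs_pos.mpr hi
      omega
    have hA : 1 ≤ A.card := Finset.card_pos.mpr ⟨0, h0A⟩
    refine ⟨A.card * (2 * A.card * (2 * A.card * width d A) ^ d), by positivity, ?_, ?_⟩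
    · have hd2 : d ≤ d ^ 2 := Nat.le_self_pow two_ne_zero d
      have hd6 : d ≤ d ^ 6 := Nat.le_self_pow (by norm_num) d
      calc A.card * (2 * A.card * (2 * A.card * width d A) ^ d)
          = 2 ^ (d + 1) * 1 * A.card ^ (d + 2) * width d A ^ d := by ring
        _ ≤ _ := by
          gcongr
          · norm_num
          · omega
          · exact Nat.one_le_pow _ _ hd
          · omega
          · omega
    · rintro x ⟨hxA, hxB, hmin⟩
      obtain ⟨m, -, hm⟩ := AddSubmonoid.mem_closure_finset.mp hxA
      have hx : x = ∑ a : {a // a ∈ A.erase 0}, m a • a.1 := by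
        rw [Finset.sum_coe_sort (A.erase 0) fun a => m a • a, Finset.sum_erase _ (by simp), hm]
      have hle := multiplicity_le_of_minimal h0A hBA' hv hW hx hxB hmin
      rw [hx]
      refine nfold_mono h0A ?_ (sum_nsmul_mem_nfold Finset.univ
        (fun a : {a // a ∈ A.erase 0} => Finset.mem_of_mem_erase a.2) _)
      refine (Finset.sum_le_card_nsmul _ _ _ fun a _ => hle a).trans ?_
      rw [Finset.card_univ, Fintype.card_coe, smul_eq_mul]
      gcongr
      exact Finset.erase_subset 0 A
end
end

section
/- Let B ∪ {0} ⊂ A ⊂ ℤ^d with A finite, |A| = ℓ ≥ 2, B a (possibly empty) linearly independent set, r = dim span_ℝ(A), and 0 ∈ ex(H(A)). If x ∈ S_abs(A,B) and dist(x, C_B) ≤ X (for some real X ≥ 0), then x ∈ N·A for some positive integer N ≤ (X+1) · 2^{10 d r} d^{11 d^5 r} ℓ^{3 d r} w(A)^{7 d^5 r}. -/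
open Pointwise MeasureTheory

noncomputable section

/-- A bound for determinants of order at most `d` whose entries are inner products of vectors in
`ℤ^d` with entries of absolute value at most `w`. -/
def gramBound (d w : ℕ) : ℕ := d.factorial * (d * w ^ 2) ^ d

lemma abs_det_le_gramBound {d w : ℕ} (hd : 0 < d) (hw : 0 < w) {J : Type*} [Fintype J]
    [DecidableEq J] (hJ : Fintype.card J ≤ d) (M : Matrix J J ℤ)
    (hM : ∀ i j, |M i j| ≤ d * (w : ℤ) ^ 2) : |M.det| ≤ gramBound d w := by
  have h := Matrix.det_le (abv := AbsoluteValue.abs) (A := M) (x := d * (w : ℤ) ^ 2) hM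
  have h1 : (Fintype.card J).factorial * (d * w ^ 2) ^ Fintype.card J ≤ gramBound d w :=
    Nat.mul_le_mul (Nat.factorial_le hJ) (Nat.pow_le_pow_right (by positivity) hJ)
  refine (show |M.det| ≤ _ from h).trans ?_
  rw [nsmul_eq_mul]
  exact_mod_cast h1

lemma abs_dotProduct_le_mul_sq {d w : ℕ} {u v : Fin d → ℤ} (hu : ∀ k, |u k| ≤ w)
    (hv : ∀ k, |v k| ≤ w) : |∑ k, u k * v k| ≤ d * (w : ℤ) ^ 2 := by
  refine (Finset.abs_sum_le_sum_abs _ _).trans ?_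
  refine (Finset.sum_le_card_nsmul _ _ ((w : ℤ) ^ 2) fun k _ => ?_).trans (by simp)
  rw [abs_mul, sq]
  exact mul_le_mul (hu k) (hv k) (abs_nonneg _) (by positivity)

/-- Cramer's rule for an overdetermined system with linearly independent integer columns: the
solution has a common denominator, and numerators, at most `gramBound d w`. -/
lemma exists_integral_multiple_of_solution {d w : ℕ} (hd : 0 < d) (hw : 0 < w) {J : Type*}
    [Fintype J] [DecidableEq J] (V : J → Fin d → ℤ) (u : Fin d → ℤ)
    (hV : ∀ j k, |V j k| ≤ w) (hu : ∀ k, |u k| ≤ w)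
    (hli : ∀ g : J → ℝ, (∀ k, ∑ j, g j * V j k = 0) → g = 0)
    (y : J → ℝ) (hy : ∀ k, ∑ j, y j * V j k = u k) :
    ∃ D : ℤ, 0 < D ∧ D ≤ gramBound d w ∧
      ∃ g : J → ℤ, (∀ j, |g j| ≤ gramBound d w) ∧ ∀ j, (g j : ℝ) = D * y j := by
  set M : Matrix (Fin d) J ℤ := Matrix.of fun k j => V j k with hMdef
  set M' : Matrix (Fin d) J ℝ := M.map (Int.castRingHom ℝ) with hM'def
  have hmv : ∀ g : J → ℝ, ∀ k, M'.mulVec g k = ∑ j, g j * V j k := fun g k => by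
    simp [M', M, Matrix.mulVec, dotProduct, mul_comm]
  have hinj : Function.Injective M'.mulVec := by
    intro g g' h
    refine sub_eq_zero.1 (hli _ fun k => ?_)
    rw [← hmv, Matrix.mulVec_sub, h, sub_self, Pi.zero_apply]
  have hJ : Fintype.card J ≤ d := by
    simpa using LinearMap.finrank_le_finrank_of_injective (f := M'.mulVecLin) hinj
  set G : Matrix J J ℤ := M.transpose * M with hG
  have hG' : G.map (Int.castRingHom ℝ) = M'.conjTranspose * M' := by
    rw [hG, Matrix.map_mul, Matrix.conjTranspose_eq_transpose_of_trivial, Matrix.transpose_map]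
  have hdet : ((G.det : ℤ) : ℝ) = (M'.conjTranspose * M').det := by
    rw [← hG']
    exact (Int.castRingHom ℝ).map_det G
  have hGb : ∀ i j, |G i j| ≤ d * (w : ℤ) ^ 2 := fun i j => by
    simpa [hG, Matrix.mul_apply, M] using abs_dotProduct_le_mul_sq (hV i) (hV j)
  refine ⟨G.det, ?_, (le_abs_self _).trans (abs_det_le_gramBound hd hw hJ _ hGb),
    G.cramer (M.transpose.mulVec u), fun j => ?_, fun j => ?_⟩
  · have := (Matrix.PosDef.conjTranspose_mul_self M' hinj).det_pos
    rw [← hdet] at this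
    exact_mod_cast this
  · rw [Matrix.cramer_apply]
    refine abs_det_le_gramBound hd hw hJ _ fun i i' => ?_
    rw [Matrix.updateCol_apply]
    split_ifs
    · simpa [Matrix.mulVec, dotProduct, M] using abs_dotProduct_le_mul_sq (hV i) hu
    · exact hGb _ _
  · have hu' : (fun k => (u k : ℝ)) = M'.mulVec y := by
      ext k
      rw [hmv, hy]
    have hcast : (fun i => ((M.transpose.mulVec u i : ℤ) : ℝ)) =
        (G.map (Int.castRingHom ℝ)).mulVec y := by
      rw [hG', ← Matrix.mulVec_mulVec, ← hu', Matrix.conjTranspose_eq_transpose_of_trivial]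
      ext i
      simp [Matrix.mulVec, dotProduct, M', M]
    have hcr : ((G.cramer (M.transpose.mulVec u) j : ℤ) : ℝ) =
        (G.map (Int.castRingHom ℝ)).cramer (fun i => ((M.transpose.mulVec u i : ℤ) : ℝ)) j := by
      rw [Matrix.cramer_eq_adjugate_mulVec, Matrix.cramer_eq_adjugate_mulVec]
      have hadj := (Int.castRingHom ℝ).map_adjugate G
      rw [RingHom.mapMatrix_apply, RingHom.mapMatrix_apply] at hadj
      rw [← hadj]
      simp [Matrix.mulVec, dotProduct]
    rw [hcr, hcast, Matrix.cramer_eq_adjugate_mulVec, Matrix.mulVec_mulVec, Matrix.adjugate_mul,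
      hG', ← hdet]
    simp [Matrix.smul_mulVec]

/-- A nonzero nonnegative real relation between integer vectors dominates, up to scaling, a nonzero
natural number relation with bounded coefficients. -/
lemma exists_nat_relation {d w : ℕ} (hd : 0 < d) (hw : 0 < w) {ι : Type*} [Fintype ι]
    [DecidableEq ι] (V : ι → Fin d → ℤ) (hV : ∀ i k, |V i k| ≤ w) (n : ℕ) :
    ∀ c : ι → ℝ, (Finset.univ.filter fun i => c i ≠ 0).card = n → (∀ i, 0 ≤ c i) → c ≠ 0 →
      (∀ k, ∑ i, c i * V i k = 0) →
    ∃ z : ι → ℕ, z ≠ 0 ∧ (∀ i, c i = 0 → z i = 0) ∧ (∀ i, z i ≤ gramBound d w) ∧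
      ∀ k, ∑ i, (z i : ℤ) * V i k = 0 := by
  induction n using Nat.strong_induction_on with
  | _ n ih =>
  intro c hcard hc hc0 hrel
  obtain ⟨i₀, hi₀⟩ := Function.ne_iff.1 hc0
  rw [Pi.zero_apply] at hi₀
  have hpos : 0 < c i₀ := (hc i₀).lt_of_ne' hi₀
  let J := {i : ι // c i ≠ 0 ∧ i ≠ i₀}
  have hsumJ : ∀ f : ι → ℝ, (∀ i, c i = 0 → f i = 0) → ∑ i, f i = f i₀ + ∑ j : J, f j := by
    intro f hf
    rw [← Finset.add_sum_erase _ _ (Finset.mem_univ i₀),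
      ← Finset.sum_subtype (Finset.univ.filter fun i => c i ≠ 0 ∧ i ≠ i₀) (by simp) f]
    congr 1
    refine (Finset.sum_subset (fun i => by simp) fun i hi hi' => hf i ?_).symm
    by_contra h
    simp_all
  by_cases hli : ∀ g : J → ℝ, (∀ k, ∑ j, g j * V j k = 0) → g = 0
  · obtain ⟨D, hD, hDle, g, hg, hgy⟩ := exists_integral_multiple_of_solution hd hw
      (fun j : J => V j) (fun k => - V i₀ k) (fun j k => hV j k) (fun k => by simpa using hV i₀ k)
      hli (fun j => c j / c i₀) (fun k => by
        have h := hrel k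
        rw [hsumJ _ fun i hi => by simp [hi]] at h
        have h' : ∑ j : J, c j / c i₀ * V j k = (∑ j : J, c j * V j k) / c i₀ := by
          rw [Finset.sum_div]
          exact Finset.sum_congr rfl fun j _ => by ring
        rw [h', div_eq_iff hi₀]
        push_cast
        linarith)
    have hg0 : ∀ j, 0 ≤ g j := fun j => by
      have h : (0 : ℝ) ≤ g j := by
        rw [hgy]
        exact mul_nonneg (by exact_mod_cast hD.le) (div_nonneg (hc _) hpos.le)
      exact_mod_cast h
    have hzc : ∃ z : ι → ℕ, ∀ i, (z i : ℝ) = D * (c i / c i₀) ∧ z i ≤ gramBound d w := by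
      have : ∀ i, ∃ m : ℕ, (m : ℝ) = D * (c i / c i₀) ∧ m ≤ gramBound d w := by
        intro i
        by_cases h0 : c i = 0
        · exact ⟨0, by simp [h0], by simp⟩
        by_cases hi : i = i₀
        · subst hi
          refine ⟨D.toNat, ?_, by omega⟩
          rw [div_self hi₀, mul_one]
          exact_mod_cast Int.toNat_of_nonneg hD.le
        · refine ⟨(g ⟨i, h0, hi⟩).toNat, ?_, ?_⟩
          · rw [← hgy ⟨i, h0, hi⟩]
            exact_mod_cast Int.toNat_of_nonneg (hg0 _)
          · have := (le_abs_self _).trans (hg ⟨i, h0, hi⟩)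
            omega
      choose z hz using this
      exact ⟨z, hz⟩
    obtain ⟨z, hz⟩ := hzc
    refine ⟨z, fun h => ?_, fun i hi => ?_, fun i => (hz i).2, fun k => ?_⟩
    · have h1 := (hz i₀).1
      rw [h, div_self hi₀, mul_one] at h1
      have h2 : D = 0 := by exact_mod_cast h1.symm
      omega
    · have h1 := (hz i).1
      rw [hi] at h1
      exact_mod_cast (by simpa using h1)
    · have h1 : ∑ i, (z i : ℝ) * V i k = 0 := by
        calc ∑ i, (z i : ℝ) * V i k = (D / c i₀) * ∑ i, c i * V i k := by
              rw [Finset.mul_sum]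
              exact Finset.sum_congr rfl fun i _ => by rw [(hz i).1]; ring
          _ = 0 := by rw [hrel, mul_zero]
      exact_mod_cast h1
  · push Not at hli
    obtain ⟨g₁, hg₁, hne⟩ := hli
    obtain ⟨g, hgrel, j₀, hgj₀⟩ : ∃ g : J → ℝ, (∀ k, ∑ j, g j * V j k = 0) ∧ ∃ j, 0 < g j := by
      obtain ⟨j, hj⟩ := Function.ne_iff.1 hne
      rcases lt_or_gt_of_ne hj with h | h
      · exact ⟨fun j => - g₁ j, fun k => by simp [hg₁ k], j, by simpa using h⟩
      · exact ⟨g₁, hg₁, j, h⟩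
    obtain ⟨j₁, hj₁, hmin⟩ := Finset.exists_min_image (Finset.univ.filter fun j => 0 < g j)
      (fun j => c j / g j) ⟨j₀, by simpa using hgj₀⟩
    simp only [Finset.mem_filter, Finset.mem_univ, true_and] at hj₁ hmin
    set t := c j₁ / g j₁ with ht
    have ht0 : 0 ≤ t := div_nonneg (hc _) hj₁.le
    let e : ι → ℝ := fun i => if h : c i ≠ 0 ∧ i ≠ i₀ then g ⟨i, h⟩ else 0
    have heJ : ∀ j : J, e j = g j := fun j => dif_pos j.2
    have he0 : ∀ i, c i = 0 → e i = 0 := fun i hi => dif_neg fun h => h.1 hi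
    have hei₀ : e i₀ = 0 := dif_neg fun h => h.2 rfl
    have hlt : (Finset.univ.filter fun i => c i - t * e i ≠ 0).card < n := by
      rw [← hcard]
      refine Finset.card_lt_card (Finset.ssubset_iff_of_subset ?_ |>.2 ⟨j₁, ?_, ?_⟩)
      · intro i
        simp only [Finset.mem_filter, Finset.mem_univ, true_and]
        exact fun h hi => h (by simp [hi, he0 i hi])
      · simpa using j₁.2.1
      · simp [heJ, ht, div_mul_cancel₀ _ hj₁.ne']
    have hnn : ∀ i, 0 ≤ c i - t * e i := by
      intro i
      by_cases h : c i ≠ 0 ∧ i ≠ i₀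
      · have h1 : e i = g ⟨i, h⟩ := heJ ⟨i, h⟩
        rw [h1]
        rcases le_or_gt (g ⟨i, h⟩) 0 with h2 | h2
        · nlinarith [hc i]
        · have := hmin ⟨i, h⟩ h2
          rw [le_div_iff₀ h2] at this
          linarith
      · have h1 : e i = 0 := dif_neg h
        simpa [h1] using hc i
    have hne0 : (fun i => c i - t * e i) ≠ 0 := by
      intro h
      have := congrFun h i₀
      simp [hei₀, hi₀] at this
    have hrel' : ∀ k, ∑ i, (c i - t * e i) * V i k = 0 := by
      intro k
      have h1 : ∑ i, e i * V i k = 0 := by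
        rw [hsumJ _ fun i hi => by simp [he0 i hi]]
        simp only [heJ, hei₀, zero_mul, zero_add]
        exact hgrel k
      calc ∑ i, (c i - t * e i) * V i k = ∑ i, c i * V i k - t * ∑ i, e i * V i k := by
            rw [Finset.mul_sum, ← Finset.sum_sub_distrib]
            exact Finset.sum_congr rfl fun i _ => by ring
        _ = 0 := by rw [hrel, h1]; ring
    obtain ⟨z, hz0, hzc, hzb, hzr⟩ := ih _ hlt _ rfl hnn hne0 hrel'
    exact ⟨z, hz0, fun i hi => hzc i (by simp [hi, he0 i hi]), hzb, hzr⟩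

/-- If a nonnegative relation `c` dominates no nonzero natural number relation vanishing on `E`,
then the total mass of `c` is controlled by its mass on `E`. -/
lemma sum_le_of_no_nat_relation {d w : ℕ} (hd : 0 < d) (hw : 0 < w) {ι : Type*} [Fintype ι]
    [DecidableEq ι] (V : ι → Fin d → ℤ) (hV : ∀ i k, |V i k| ≤ w) (E : Finset ι) (n : ℕ) :
    ∀ c : ι → ℝ, (Finset.univ.filter fun i => c i ≠ 0).card = n → (∀ i, 0 ≤ c i) →
      (∀ k, ∑ i, c i * V i k = 0) →
      (∀ z : ι → ℕ, (∀ k, ∑ i, (z i : ℤ) * V i k = 0) → (∀ i ∈ E, z i = 0) →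
        (∀ i, (z i : ℝ) ≤ c i) → z = 0) →
    ∑ i, c i ≤ (n + ∑ i ∈ E, c i) * (Fintype.card ι * gramBound d w) := by
  induction n using Nat.strong_induction_on with
  | _ n ih =>
  intro c hcard hc hrel hno
  have hE : 0 ≤ ∑ i ∈ E, c i := Finset.sum_nonneg fun i _ => hc i
  by_cases hc0 : c = 0
  · subst hc0
    simp only [Pi.zero_apply, Finset.sum_const_zero]
    positivity
  obtain ⟨z, hz0, hzc, hzb, hzr⟩ := exists_nat_relation hd hw V hV n c hcard hc hc0 hrel
  obtain ⟨j₀, hj₀⟩ := Function.ne_iff.1 hz0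
  obtain ⟨j₁, hj₁, hmin⟩ := Finset.exists_min_image (Finset.univ.filter fun j => 0 < z j)
    (fun j => c j / z j) ⟨j₀, by simpa using Nat.pos_of_ne_zero hj₀⟩
  simp only [Finset.mem_filter, Finset.mem_univ, true_and] at hj₁ hmin
  set t := c j₁ / z j₁ with ht
  have ht0 : 0 ≤ t := div_nonneg (hc _) (Nat.cast_nonneg _)
  have hj₁' : (z j₁ : ℝ) ≠ 0 := by exact_mod_cast hj₁.ne'
  have hle : ∀ i, t * z i ≤ c i := by
    intro i
    rcases Nat.eq_zero_or_pos (z i) with h | h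
    · simpa [h] using hc i
    · exact (le_div_iff₀ (by exact_mod_cast h)).1 (hmin i h)
  set c' : ι → ℝ := fun i => c i - t * z i with hc'
  have hlt : (Finset.univ.filter fun i => c' i ≠ 0).card < n := by
    rw [← hcard]
    refine Finset.card_lt_card (Finset.ssubset_iff_of_subset ?_ |>.2 ⟨j₁, ?_, ?_⟩)
    · intro i
      simp only [Finset.mem_filter, Finset.mem_univ, true_and]
      exact fun h hi => h (by simp [hc', hi, hzc i hi])
    · simp only [Finset.mem_filter, Finset.mem_univ, true_and]
      exact fun h => hj₁.ne' (hzc _ h)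
    · simp [hc', ht, div_mul_cancel₀ _ hj₁']
  have key := ih _ hlt c' rfl (fun i => by simpa [hc'] using hle i) (fun k => by
    have h1 : ∑ i, (z i : ℝ) * V i k = 0 := by exact_mod_cast hzr k
    calc ∑ i, c' i * V i k = ∑ i, c i * V i k - t * ∑ i, (z i : ℝ) * V i k := by
          rw [Finset.mul_sum, ← Finset.sum_sub_distrib]
          exact Finset.sum_congr rfl fun i _ => by simp only [hc']; ring
      _ = 0 := by rw [hrel, h1]; ring)
    (fun y hy hyE hyc => hno y hy hyE fun i => (hyc i).trans (by
      simpa [hc'] using mul_nonneg ht0 (Nat.cast_nonneg _)))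
  have hsum : ∑ i, c i = ∑ i, c' i + t * ∑ i, (z i : ℝ) := by
    rw [Finset.mul_sum, ← Finset.sum_add_distrib]
    exact Finset.sum_congr rfl fun i _ => by simp only [hc']; ring
  have hsumE : ∑ i ∈ E, c i = ∑ i ∈ E, c' i + t * ∑ i ∈ E, (z i : ℝ) := by
    rw [Finset.mul_sum, ← Finset.sum_add_distrib]
    exact Finset.sum_congr rfl fun i _ => by simp only [hc']; ring
  have hzsum : ∑ i, (z i : ℝ) ≤ Fintype.card ι * gramBound d w := by
    refine (Finset.sum_le_card_nsmul _ _ (gramBound d w : ℝ) fun i _ => ?_).trans (by simp)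
    exact_mod_cast hzb i
  set K : ℝ := Fintype.card ι * gramBound d w with hK
  have hK0 : 0 ≤ K := by positivity
  set m := (Finset.univ.filter fun i => c' i ≠ 0).card
  have hmn : (m : ℝ) + 1 ≤ n := by exact_mod_cast hlt
  have htz : t ≤ 1 + t * ∑ i ∈ E, (z i : ℝ) := by
    by_cases hzE : ∀ i ∈ E, z i = 0
    · rw [Finset.sum_eq_zero fun i hi => by simp [hzE i hi]]
      by_contra! h
      refine hz0 (hno z hzr hzE fun i => ?_)
      have := hle i
      nlinarith [(Nat.cast_nonneg (z i) : (0 : ℝ) ≤ z i)]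
    · push Not at hzE
      obtain ⟨i, hi, hzi⟩ := hzE
      have h1 : (1 : ℝ) ≤ z i := by exact_mod_cast Nat.pos_of_ne_zero hzi
      have h2 := Finset.single_le_sum (f := fun i => (z i : ℝ)) (fun i _ => Nat.cast_nonneg _) hi
      nlinarith
  calc ∑ i, c i ≤ (m + ∑ i ∈ E, c' i) * K + t * K := by
        rw [hsum]
        exact add_le_add key (mul_le_mul_of_nonneg_left hzsum ht0)
    _ = (m + ∑ i ∈ E, c' i + t) * K := by ring
    _ ≤ _ := mul_le_mul_of_nonneg_right (by linarith) hK0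

lemma mem_nfold_sum {d : ℕ} {A : Finset (Fin d → ℤ)} (n : (Fin d → ℤ) → ℕ) :
    ∑ a ∈ A, n a • a ∈ nfold d ↑A (∑ a ∈ A, n a) := by
  set s : Multiset (Fin d → ℤ) := ∑ a ∈ A, Multiset.replicate (n a) a with hs
  have hcard : s.toList.length = ∑ a ∈ A, n a := by
    simp [hs]
  have hsum : s.sum = ∑ a ∈ A, n a • a := by
    simp [hs, Multiset.sum_sum]
  rw [← hcard]
  refine ⟨fun i => s.toList.get i, fun i => ?_, ?_⟩
  · have h : s.toList.get i ∈ s := Multiset.mem_toList.1 (List.get_mem _ _)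
    obtain ⟨a, ha, h⟩ := Multiset.mem_sum.1 h
    exact Set.mem_of_eq_of_mem (Multiset.eq_of_mem_replicate h) ha
  · rw [← hsum, ← Multiset.sum_toList, ← List.sum_ofFn, List.ofFn_get]

lemma nfold_subset_succ {d : ℕ} {A : Set (Fin d → ℤ)} (h0 : 0 ∈ A) (N : ℕ) :
    nfold d A N ⊆ nfold d A (N + 1) := by
  rintro _ ⟨f, hf, rfl⟩
  exact ⟨Fin.cons 0 f, fun i => Fin.cases h0 hf i, by simp [Fin.sum_univ_succ]⟩

lemma sum_smul_mem_PA {d : ℕ} {A : Finset (Fin d → ℤ)} (h0 : 0 ∈ A) (n : (Fin d → ℤ) → ℕ) :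
    ∑ a ∈ A, n a • a ∈ PA d ↑A :=
  Set.mem_biUnion (x := ∑ a ∈ A, n a + 1) (by simp)
    (nfold_subset_succ (by simpa using h0) _ (mem_nfold_sum n))

lemma exists_sum_smul_of_mem_PA {d : ℕ} {A : Finset (Fin d → ℤ)} {x : Fin d → ℤ}
    (hx : x ∈ PA d ↑A) :
    ∃ n : (Fin d → ℤ) → ℕ, n 0 = 0 ∧ x = ∑ a ∈ A, n a • a := by
  simp only [PA, Set.mem_iUnion] at hx
  obtain ⟨N, -, f, hf, rfl⟩ := hx
  refine ⟨fun a => if a = 0 then 0 else (Finset.univ.filter fun i => f i = a).card, by simp, ?_⟩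
  rw [← Finset.sum_fiberwise_of_maps_to (s := Finset.univ) (t := A) (g := f)
    fun i _ => by simpa using hf i]
  refine Finset.sum_congr rfl fun a _ => ?_
  rw [Finset.sum_congr rfl fun i hi => (Finset.mem_filter.1 hi).2, Finset.sum_const]
  by_cases h : a = 0 <;> simp [h]

lemma abs_sub_le_width {d : ℕ} {A : Finset (Fin d → ℤ)} {a b : Fin d → ℤ} (ha : a ∈ A)
    (hb : b ∈ A) (k : Fin d) : |a k - b k| ≤ width d A := by
  have h1 : (a k - b k).natAbs ≤ Finset.univ.sup fun i => (a i - b i).natAbs :=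
    Finset.le_sup (f := fun i => (a i - b i).natAbs) (Finset.mem_univ k)
  have h2 := Finset.le_sup (f := fun p : (Fin d → ℤ) × (Fin d → ℤ) =>
    Finset.univ.sup fun i => (p.1 i - p.2 i).natAbs) (Finset.mk_mem_product ha hb)
  have := h1.trans h2
  rw [Int.abs_eq_natAbs]
  exact_mod_cast this

lemma width_pos {d : ℕ} {A : Finset (Fin d → ℤ)} (hl : 2 ≤ A.card) : 0 < width d A := by
  obtain ⟨a, ha, b, hb, hab⟩ := Finset.one_lt_card.1 hl
  obtain ⟨k, hk⟩ := Function.ne_iff.1 hab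
  have h1 := abs_pos.2 (sub_ne_zero.2 hk)
  have h2 := abs_sub_le_width ha hb k
  omega

/-- Nonnegative combinations of `A` vanish only trivially when `0` is an extreme point. -/
lemma eq_zero_of_sum_smul_eq_zero {d : ℕ} {A : Finset (Fin d → ℤ)} (h0 : (0 : Fin d → ℤ) ∈ exP d A)
    (n : (Fin d → ℤ) → ℕ) (hn : ∑ a ∈ A, n a • a = 0) {a : Fin d → ℤ} (ha : a ∈ A)
    (ha0 : a ≠ 0) : n a = 0 := by
  obtain ⟨-, v, -, -, hv⟩ := h0
  let φ : (Fin d → ℤ) → ℝ := fun a => ∑ i, v i * emb d a i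
  have hpos : ∀ a ∈ A, a ≠ 0 → 0 < φ a := by
    intro a ha ha0
    have h := hv (emb d a) (subset_convexHull ℝ _ ⟨a, by simpa using ha, rfl⟩) fun h => ha0 <| by
      ext i
      simpa [emb] using congrFun h i
    simpa [emb, φ] using h
  have hsum : ∑ a ∈ A, (n a : ℝ) * φ a = 0 := by
    have h1 : ∀ i, ∑ a ∈ A, (n a : ℝ) * a i = 0 := fun i => by
      have := congrFun hn i
      simp only [Finset.sum_apply, Pi.zero_apply, nsmul_eq_mul] at this
      exact_mod_cast this
    simp only [φ, Finset.mul_sum]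
    rw [Finset.sum_comm]
    refine Finset.sum_eq_zero fun i _ => ?_
    rw [← mul_zero (v i), ← h1 i, Finset.mul_sum]
    exact Finset.sum_congr rfl fun a _ => by simp only [emb]; ring
  have hnn : ∀ a ∈ A, 0 ≤ (n a : ℝ) * φ a := by
    intro a ha
    by_cases h : a = 0
    · simp [h, φ, emb]
    · exact mul_nonneg (Nat.cast_nonneg _) (hpos a ha h).le
  have := (Finset.sum_eq_zero_iff_of_nonneg hnn).1 hsum a ha
  simpa [(hpos a ha ha0).ne'] using this

lemma exists_mem_cone_near {d : ℕ} (B : Finset (Fin d → ℤ)) {x : Fin d → ℝ} {X : ℝ}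
    (h : Metric.infDist x (cone d B) ≤ X) :
    ∃ c : (Fin d → ℤ) → ℝ, (∀ a, 0 ≤ c a) ∧
      ∀ k, |x k - ∑ b ∈ B, c b * b k| ≤ X + 1 := by
  have hne : (cone d B).Nonempty := ⟨0, 0, by simp, by simp⟩
  obtain ⟨_, ⟨c, hc, rfl⟩, hy⟩ := (Metric.infDist_lt_iff hne).1 (h.trans_lt (lt_add_one X))
  refine ⟨c, hc, fun k => ?_⟩
  have := (dist_le_pi_dist _ _ k).trans hy.le
  simpa [Real.dist_eq, Finset.sum_apply, emb] using this

/-- Every representation of an absolutely `B`-minimal element near the cone of `B` is short. -/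
lemma sum_le_of_abs_minimal {d : ℕ} {A B : Finset (Fin d → ℤ)} (hBA : B ⊆ A) (hA0 : 0 ∈ A)
    (hl : 2 ≤ A.card) (hd : 0 < d) (h0 : (0 : Fin d → ℤ) ∈ exP d A) {x : Fin d → ℤ}
    (hmin : ∀ b ∈ B, x - b ∉ PA d ↑A) {X : ℝ}
    (hdist : Metric.infDist (emb d x) (cone d B) ≤ X) (n : (Fin d → ℤ) → ℕ) (hn0 : n 0 = 0)
    (hxn : x = ∑ a ∈ A, n a • a) :
    ((∑ a ∈ A, n a : ℕ) : ℝ) ≤ (A.card + d + d * (X + 1)) *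
      ((A.card + d) * gramBound d (width d A)) := by
  obtain ⟨c, hc, hcx⟩ := exists_mem_cone_near B hdist
  have hw := width_pos hl
  have habs : ∀ a ∈ A, ∀ k, |a k| ≤ width d A := fun a ha k => by
    simpa using abs_sub_le_width ha hA0 k
  have hshift : ∀ b ∈ B, ∀ m : (Fin d → ℤ) → ℕ, x = ∑ a ∈ A, m a • a → m b = 0 := by
    intro b hb m hm
    by_contra hne
    refine hmin b hb ?_
    have h1 : x - b = ∑ a ∈ A, (if a = b then m a - 1 else m a) • a := by
      rw [hm, sub_eq_iff_eq_add, ← Finset.add_sum_erase _ _ (hBA hb),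
        ← Finset.add_sum_erase (a := b) A _ (hBA hb), if_pos rfl,
        Finset.sum_congr (f := fun a => (if a = b then m a - 1 else m a) • a)
          (g := fun a => m a • a) rfl fun a ha => by
            simp only [if_neg (Finset.ne_of_mem_erase ha)]]
      obtain ⟨p, hp⟩ := Nat.exists_eq_succ_of_ne_zero hne
      rw [hp, Nat.succ_sub_one, Nat.succ_eq_add_one, succ_nsmul]
      abel
    rw [h1]
    exact sum_smul_mem_PA hA0 _
  let e : Fin d → ℝ := fun k => x k - ∑ b ∈ B, c b * b k
  let V : {a // a ∈ A} ⊕ Fin d → Fin d → ℤ := Sum.elim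
    (fun a => if a.1 ∈ B then -a.1 else a.1)
    (fun i k => if k = i then (if 0 ≤ e i then -1 else 1) else 0)
  let C : {a // a ∈ A} ⊕ Fin d → ℝ := Sum.elim
    (fun a => if a.1 ∈ B then c a.1 else n a.1) (fun i => |e i|)
  have hV : ∀ i k, |V i k| ≤ width d A := by
    rintro (a | i) k
    · have := habs a.1 a.2 k
      simp only [V, Sum.elim_inl]
      split_ifs
      · simpa using this
      · exact this
    · simp only [V, Sum.elim_inr]
      split_ifs <;> simp <;> omega
  have hC : ∀ i, 0 ≤ C i := by
    rintro (a | i)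
    · simp only [C, Sum.elim_inl]
      split_ifs
      · exact hc _
      · exact Nat.cast_nonneg _
    · exact abs_nonneg _
  have hsplit : ∀ (f : (Fin d → ℤ) → ℝ), ∑ b ∈ B, f b = ∑ a ∈ A, if a ∈ B then f a else 0 :=
    fun f => by rw [Finset.sum_ite_mem, Finset.inter_eq_right.2 hBA]
  have hrel : ∀ k, ∑ i, C i * V i k = 0 := by
    intro k
    rw [Fintype.sum_sum_type]
    have h1 : ∑ i : Fin d, C (Sum.inr i) * V (Sum.inr i) k = - e k := by
      rw [Finset.sum_eq_single k (fun i _ hi => by simp [V, hi.symm]) (by simp)]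
      simp only [C, V, Sum.elim_inr, if_true]
      split_ifs with h
      · simp [abs_of_nonneg h]
      · simp [abs_of_neg (not_le.1 h)]
    have h2 : ∑ a : {a // a ∈ A}, C (Sum.inl a) * V (Sum.inl a) k = e k := by
      simp only [e]
      rw [hsplit, hxn, ← Finset.sum_coe_sort A, ← Finset.sum_coe_sort A, Finset.sum_apply,
        Int.cast_sum, ← Finset.sum_sub_distrib]
      refine Finset.sum_congr rfl fun a _ => ?_
      simp only [C, V, Sum.elim_inl]
      split_ifs with h
      · simp [hshift _ h n hxn]
      · simp
    rw [h1, h2, add_neg_cancel]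
  have key := sum_le_of_no_nat_relation hd hw V hV (Finset.univ.map Function.Embedding.inr) _ C
    rfl hC hrel ?_
  · have hcard : Fintype.card ({a // a ∈ A} ⊕ Fin d) = A.card + d := by simp
    rw [Finset.sum_map, hcard] at key
    have hE : ∑ i : Fin d, C (Function.Embedding.inr i) ≤ d * (X + 1) := by
      refine (Finset.sum_le_card_nsmul _ _ (X + 1) fun i _ => hcx i).trans (by simp [mul_add])
    have hsupp : ((Finset.univ.filter fun i => C i ≠ 0).card : ℝ) ≤ A.card + d := by
      exact_mod_cast (Finset.card_le_univ _).trans hcard.le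
    have hle : ((∑ a ∈ A, n a : ℕ) : ℝ) ≤ ∑ i, C i := by
      rw [Fintype.sum_sum_type, Nat.cast_sum, ← Finset.sum_coe_sort A]
      refine le_add_of_le_of_nonneg (Finset.sum_le_sum fun a _ => ?_)
        (Finset.sum_nonneg fun i _ => hC _)
      simp only [C, Sum.elim_inl]
      split_ifs with h
      · simp [hshift _ h n hxn, hc]
      · exact le_rfl
    refine (hle.trans key).trans ?_
    push_cast
    gcongr
  · intro z hz hzE hzC
    have hzr : ∀ i, z (Sum.inr i) = 0 := fun i => hzE _ (by simp)
    have hz' : ∀ k, ∑ a : {a // a ∈ A}, (z (Sum.inl a) : ℤ) * V (Sum.inl a) k = 0 := by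
      intro k
      have h := hz k
      rw [Fintype.sum_sum_type] at h
      simpa [hzr] using h
    let y : (Fin d → ℤ) → ℕ := fun a => if h : a ∈ A then z (Sum.inl ⟨a, h⟩) else 0
    have hy : ∀ a : {a // a ∈ A}, y a = z (Sum.inl a) := fun a => dif_pos a.2
    have hyn : ∀ a ∈ A, a ∉ B → y a ≤ n a := by
      intro a ha haB
      have := hzC (Sum.inl ⟨a, ha⟩)
      simp only [C, Sum.elim_inl, if_neg haB] at this
      rw [← hy ⟨a, ha⟩] at this
      exact_mod_cast this
    have hyB : ∀ b ∈ B, y b = 0 := by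
      intro b hb
      have hm := hshift b hb (fun a => if a ∈ B then y a else n a - y a) (by
        rw [hxn]
        ext k
        rw [← sub_eq_zero, Finset.sum_apply, Finset.sum_apply, ← Finset.sum_sub_distrib,
          ← Finset.sum_coe_sort A, ← hz' k]
        refine Finset.sum_congr rfl fun a _ => ?_
        rw [← hy]
        simp only [V, Sum.elim_inl]
        split_ifs with h
        · simp [hshift _ h n hxn]
        · simp [Nat.cast_sub (hyn _ a.2 h)]
          ring)
      simpa [hb] using hm
    have hysum : ∑ a ∈ A, y a • a = 0 := by
      ext k
      rw [Finset.sum_apply, ← Finset.sum_coe_sort A, Pi.zero_apply, ← hz' k]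
      refine Finset.sum_congr rfl fun a _ => ?_
      rw [← hy]
      simp only [V, Sum.elim_inl]
      split_ifs with h
      · simp [hyB _ h]
      · simp
    have hB0 : (0 : Fin d → ℤ) ∈ B → False := fun h =>
      hmin 0 h (by rw [sub_zero, hxn]; exact sum_smul_mem_PA hA0 n)
    ext i
    rcases i with a | i
    · rw [← hy, Pi.zero_apply]
      by_cases ha : a.1 = 0
      · have := hyn a.1 a.2 fun h => hB0 (ha ▸ h)
        rw [ha, hn0] at this
        rw [ha]
        omega
      · exact eq_zero_of_sum_smul_eq_zero h0 y hysum a.2 ha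
    · exact hzr i

lemma bound_le {d r l w : ℕ} (hd : 0 < d) (hr : 0 < r) (hl : 2 ≤ l) (hw : 0 < w) {X : ℝ}
    (hX : 0 ≤ X) :
    (l + d + d * (X + 1)) * ((l + d) * gramBound d w) + 1 ≤
      (X + 1) * 2 ^ (10 * d * r) * (d : ℝ) ^ (11 * d ^ 5 * r) * (l : ℝ) ^ (3 * d * r) *
        (w : ℝ) ^ (7 * d ^ 5 * r) := by
  have hd1 : (1 : ℝ) ≤ d := by exact_mod_cast hd
  have hl2 : (2 : ℝ) ≤ l := by exact_mod_cast hl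
  have hw1 : (1 : ℝ) ≤ w := by exact_mod_cast hw
  have hdr : 1 ≤ d * r := Nat.mul_pos hd hr
  have hd5 : d ≤ d ^ 5 * r := (Nat.le_self_pow (by norm_num) d).trans (Nat.le_mul_of_pos_right _ hr)
  have hgram : (gramBound d w : ℝ) ≤ (d : ℝ) ^ (2 * d) * (w : ℝ) ^ (2 * d) := by
    have h : gramBound d w ≤ d ^ (2 * d) * w ^ (2 * d) := by
      calc gramBound d w ≤ d ^ d * (d * w ^ 2) ^ d := Nat.mul_le_mul_right _ (Nat.factorial_le_pow d)
        _ = _ := by rw [mul_pow, ← pow_mul]; ring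
    exact_mod_cast h
  set P : ℝ := (d : ℝ) ^ (2 * d) * (w : ℝ) ^ (2 * d) with hP
  have hP1 : 1 ≤ P := one_le_mul_of_one_le_of_one_le (one_le_pow₀ hd1) (one_le_pow₀ hw1)
  have hdl : (l : ℝ) + d ≤ 2 * (d * l) := by nlinarith
  have hfirst : l + d + d * (X + 1) ≤ (X + 1) * (3 * (d * l)) := by nlinarith
  have hdl1 : (1 : ℝ) ≤ d * l := by nlinarith
  calc (l + d + d * (X + 1)) * ((l + d) * gramBound d w) + 1
      ≤ ((X + 1) * (3 * (d * l))) * (2 * (d * l) * P) + (X + 1) * ((d * l) ^ 2 * P) := by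
        gcongr
        have : 1 ≤ (d * l : ℝ) ^ 2 * P :=
          one_le_mul_of_one_le_of_one_le (one_le_pow₀ hdl1) hP1
        nlinarith
    _ = (X + 1) * 7 * (d : ℝ) ^ (2 * d + 2) * (l : ℝ) ^ 2 * (w : ℝ) ^ (2 * d) := by
        rw [hP, pow_add]; ring
    _ ≤ _ := by
        have h7 : (7 : ℝ) ≤ 2 ^ (10 * d * r) := by
          refine (by norm_num : (7 : ℝ) ≤ 2 ^ 10).trans (pow_le_pow_right₀ (by norm_num) ?_)
          nlinarith
        gcongr (X + 1) * ?_ * (d : ℝ) ^ ?_ * (l : ℝ) ^ ?_ * (w : ℝ) ^ ?_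
        all_goals first | exact hd1 | linarith
/-- Controlling absolutely `B`-minimal elements: if `x ∈ S_abs(A,B)` and
`dist(x, C_B) ≤ X`, then `x ∈ NA` for some
`N ≤ (X+1)·2^{10dr}·d^{11d⁵r}·ℓ^{3dr}·w(A)^{7d⁵r}` where `r = dim span_ℝ(A)`. -/
theorem controlling_abs_B_minimal (d : ℕ) (A B : Finset (Fin d → ℤ))
    (hBA : (B : Set (Fin d → ℤ)) ∪ {0} ⊆ (A : Set (Fin d → ℤ)))
    (hl : 2 ≤ A.card)
    (hli : LinearIndependent ℝ (fun x : {x // x ∈ B} => emb d x.1))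
    (h0 : (0 : Fin d → ℤ) ∈ exP d A)
    (r : ℕ) (hr : r = Module.finrank ℝ (Submodule.span ℝ (emb d '' (A : Set (Fin d → ℤ)))))
    (x : Fin d → ℤ)
    (hx : x ∈ PA d ↑A) (hmin : ∀ b ∈ B, x - b ∉ PA d ↑A)
    (X : ℝ) (hX : 0 ≤ X) (hdist : Metric.infDist (emb d x) (cone d B) ≤ X) :
    ∃ N : ℕ, 0 < N ∧
      (N : ℝ) ≤ (X + 1) * 2 ^ (10 * d * r) * (d : ℝ) ^ (11 * d ^ 5 * r)
          * (A.card : ℝ) ^ (3 * d * r) * (width d A : ℝ) ^ (7 * d ^ 5 * r) ∧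
      x ∈ nfold d ↑A N := by
  have hA0 : (0 : Fin d → ℤ) ∈ A := by simpa using hBA (Or.inr rfl)
  have hBA' : B ⊆ A := fun b hb => by simpa using hBA (Or.inl (by simpa using hb))
  obtain ⟨a, ha, ha0⟩ := Finset.exists_mem_ne hl 0
  have hd : 0 < d := by
    obtain ⟨k, -⟩ := Function.ne_iff.1 ha0
    exact k.pos
  have hr0 : 0 < r := by
    rw [hr, Module.finrank_pos_iff_exists_ne_zero]
    refine ⟨⟨emb d a, Submodule.subset_span ⟨a, by simpa using ha, rfl⟩⟩, fun h => ha0 ?_⟩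
    ext k
    simpa [emb] using congrFun (congrArg Subtype.val h) k
  obtain ⟨n, hn0, hxn⟩ := exists_sum_smul_of_mem_PA hx
  refine ⟨∑ a ∈ A, n a + 1, Nat.succ_pos _, ?_,
    nfold_subset_succ (by simpa using hA0) _ (hxn ▸ mem_nfold_sum n)⟩
  refine le_trans ?_ (bound_le hd hr0 hl (width_pos hl) hX)
  rw [Nat.cast_succ]
  gcongr
  exact sum_le_of_abs_minimal hBA' hA0 hl hd h0 hmin hdist n hn0 hxn
end
end

section
/- Let d, d_1, d_2 be integers with d ≥ 1 and 0 ≤ d_1, d_2 ≤ d. Let B_1, B_2 ⊂ ℤ^d be finite sets with |B_i| = d_i, each of B_1 and B_2 linearly independent, and max_{b ∈ B_1 ∪ B_2} ‖b‖_∞ ≤ K where K ≥ 1. Let x ∈ ℝ^d and suppose dist(x, C_{B_1}) ≤ X_1 and dist(x, C_{B_2}) ≤ X_2. Then dist(x, C_{B_1} ∩ C_{B_2}) ≤ (X_1 + X_2) · 2^{2d} d^{10 d^5} K^{4 d^5}. -/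
open Pointwise MeasureTheory

noncomputable section

/-- Coefficients of a vector of norm at most `ρ` in a linearly independent family of integer
vectors are bounded by Cramer's rule applied to the Gram matrix. -/
lemma abs_coeff_le_of_linearIndependent {d K : ℕ} (hd : 1 ≤ d) (hK : 1 ≤ K) {κ : Type*}
    [Fintype κ] (v : κ → Fin d → ℤ)
    (hv : LinearIndependent ℝ fun k => emb d (v k)) (hvK : ∀ k i, (v k i).natAbs ≤ K)
    (q : κ → ℝ) {ρ : ℝ} (hρ : 0 < ρ) (hq : ‖∑ k, q k • emb d (v k)‖ ≤ ρ) (k : κ) :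
    |q k| ≤ ((d * K : ℕ) : ℝ) ^ (2 * d) * ρ := by
  classical
  have hd' : (1 : ℝ) ≤ d := by exact_mod_cast hd
  have hK' : (1 : ℝ) ≤ K := by exact_mod_cast hK
  have hvR : ∀ k i, |(v k i : ℝ)| ≤ K := fun k i => by
    have := hvK k i
    rw [← Int.cast_abs, Int.abs_eq_natAbs]
    exact_mod_cast this
  have hcard : Fintype.card κ ≤ d := by simpa using hv.fintype_card_le_finrank
  set M : Matrix (Fin d) κ ℤ := Matrix.of fun i k => v k i with hM
  set MR : Matrix (Fin d) κ ℝ := M.map (Int.castRingHom ℝ) with hMR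
  set G : Matrix κ κ ℤ := M.transpose * M with hG
  set GR : Matrix κ κ ℝ := MR.transpose * MR with hGR
  have hGmap : GR = G.map (Int.castRingHom ℝ) := by
    rw [hG, Matrix.map_mul, hGR, hMR, Matrix.transpose_map]
  have hmul : ∀ w : κ → ℝ, MR.mulVec w = ∑ k, w k • emb d (v k) := fun w => by
    ext i
    simp [Matrix.mulVec, dotProduct, hMR, hM, emb, Finset.sum_apply, mul_comm]
  have hdet : GR.det ≠ 0 := by
    intro h0
    obtain ⟨w, hw0, hw⟩ := Matrix.exists_mulVec_eq_zero_iff.mpr h0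
    have h1 : MR.mulVec w = 0 := by
      have h2 : dotProduct (MR.mulVec w) (MR.mulVec w) = 0 := by
        have h3 : dotProduct w (GR.mulVec w) = 0 := by rw [hw]; simp
        rw [hGR, ← Matrix.mulVec_mulVec, Matrix.dotProduct_mulVec, Matrix.vecMul_transpose] at h3
        exact h3
      exact dotProduct_self_eq_zero.mp h2
    rw [hmul] at h1
    exact hw0 (funext (Fintype.linearIndependent_iff.mp hv w h1))
  have hdet1 : 1 ≤ |GR.det| := by
    have h : GR.det = ((G.det : ℤ) : ℝ) := by
      rw [hGmap]
      exact ((Int.castRingHom ℝ).map_det G).symm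
    rw [h] at hdet ⊢
    have : G.det ≠ 0 := by exact_mod_cast hdet
    exact_mod_cast Int.one_le_abs this
  set b : κ → ℝ := fun k => ρ⁻¹ * MR.transpose.mulVec (MR.mulVec q) k with hb
  have hGq : GR.mulVec q = ρ • b := by
    ext k
    rw [hGR, ← Matrix.mulVec_mulVec]
    simp [hb, hρ.ne']
  have hcr : GR.det * q k = ρ * GR.cramer b k := by
    have h := congrArg (GR.adjugate.mulVec) hGq
    rw [Matrix.mulVec_mulVec, Matrix.adjugate_mul, Matrix.smul_mulVec, Matrix.one_mulVec,
      Matrix.mulVec_smul, ← Matrix.cramer_eq_adjugate_mulVec] at h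
    simpa using congrFun h k
  have hMq : ∀ i, |MR.mulVec q i| ≤ ρ := fun i => by
    rw [hmul]
    exact (norm_le_pi_norm _ i).trans hq
  have hMRb : ∀ i k, |MR i k| ≤ K := fun i k => by simpa [hMR, hM] using hvR k i
  have hbb : ∀ k, |b k| ≤ d * K ^ 2 := fun k => by
    have h1 : |MR.transpose.mulVec (MR.mulVec q) k| ≤ d * (K * ρ) := by
      simp only [Matrix.mulVec, dotProduct] at hMq ⊢
      refine (Finset.abs_sum_le_sum_abs _ _).trans ?_
      refine (Finset.sum_le_card_nsmul _ _ (K * ρ) fun i _ => ?_).trans (by simp)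
      rw [abs_mul]
      exact mul_le_mul (hMRb i k) (hMq i) (abs_nonneg _) (by positivity)
    have h2 : |b k| ≤ d * K := by
      simp only [hb, abs_mul, abs_inv, abs_of_pos hρ]
      rw [inv_mul_le_iff₀ hρ]
      linarith
    nlinarith [mul_le_mul_of_nonneg_left hK' (by positivity : (0 : ℝ) ≤ d * K)]
  have hGb : ∀ i j, |GR i j| ≤ d * K ^ 2 := fun i j => by
    rw [hGR, Matrix.mul_apply]
    refine (Finset.abs_sum_le_sum_abs _ _).trans ?_
    refine (Finset.sum_le_card_nsmul _ _ ((K : ℝ) ^ 2) fun l _ => ?_).trans (by simp)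
    rw [abs_mul, sq]
    exact mul_le_mul (hMRb l i) (hMRb l j) (abs_nonneg _) (by positivity)
  have hcb : |GR.cramer b k| ≤ ((d * K : ℕ) : ℝ) ^ (2 * d) := by
    have h1 := Matrix.det_le (A := GR.updateCol k b) (abv := AbsoluteValue.abs)
      (x := (d * K ^ 2 : ℝ)) (fun i j => by
        by_cases hj : j = k
        · subst hj; simpa using hbb i
        · simpa [Matrix.updateCol_ne hj] using hGb i j)
    rw [Matrix.cramer_apply]
    refine h1.trans ?_
    have h2 : ((Fintype.card κ).factorial : ℝ) ≤ (d : ℝ) ^ d := by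
      exact_mod_cast (Nat.factorial_le hcard).trans (Nat.factorial_le_pow d)
    have h3 : (d * K ^ 2 : ℝ) ^ Fintype.card κ ≤ (d * K ^ 2 : ℝ) ^ d :=
      pow_le_pow_right₀ (by nlinarith [one_le_pow₀ hK' (n := 2)]) hcard
    rw [nsmul_eq_mul]
    refine (mul_le_mul h2 h3 (by positivity) (by positivity)).trans (le_of_eq ?_)
    push_cast
    ring
  have hfin : |q k| ≤ |GR.det * q k| := by
    rw [abs_mul]
    exact le_mul_of_one_le_left (abs_nonneg _) hdet1
  rw [hcr, abs_mul, abs_of_pos hρ] at hfin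
  rw [mul_comm]
  exact hfin.trans (mul_le_mul_of_nonneg_left hcb hρ.le)

/-- Moving from a nonnegative vector `c` in a direction `-z` with a positive entry, within the
support of `c`, one reaches a nonnegative vector of smaller support. -/
lemma exists_sub_smul_support_ssubset {ι : Type*} [Fintype ι] (c z : ι → ℝ) (hc : ∀ i, 0 ≤ c i)
    (hz : ∀ i, c i = 0 → z i = 0) (hpos : ∃ i, 0 < z i) :
    ∃ t : ℝ, 0 < t ∧ (∀ i, 0 ≤ c i - t * z i) ∧
      Function.support (fun i => c i - t * z i) ⊂ Function.support c := by
  classical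
  obtain ⟨i₀, hi₀⟩ := hpos
  obtain ⟨j, hj, hmin⟩ := Finset.exists_min_image (Finset.univ.filter fun i => 0 < z i)
    (fun i => c i / z i) ⟨i₀, by simpa using hi₀⟩
  simp only [Finset.mem_filter, Finset.mem_univ, true_and] at hj hmin
  have hcj : 0 < c j := lt_of_le_of_ne (hc j) fun h => hj.ne' (hz j h.symm)
  refine ⟨c j / z j, div_pos hcj hj, fun i => ?_, ?_, fun hsub => ?_⟩
  · rcases lt_or_ge 0 (z i) with h | h
    · have := (le_div_iff₀ h).mp (hmin i h)
      linarith
    · nlinarith [hc i, div_pos hcj hj]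
  · intro i hi hci
    exact hi (by simp [hci, hz i hci])
  · exact hsub (show j ∈ Function.support c from hcj.ne') (by simp [hj.ne'])

/-- A nonnegative combination of norm at most `ρ` has coefficients close to those of a
nonnegative relation, as soon as this is so for linearly independent families. -/
lemma exists_nonneg_relation_near {E : Type*} [NormedAddCommGroup E] [NormedSpace ℝ E]
    {ι : Type*} [Fintype ι] (u : ι → E) {ρ M : ℝ}
    (hM : ∀ c : ι → ℝ, LinearIndepOn ℝ u (Function.support c) → ‖∑ i, c i • u i‖ ≤ ρ →
      ∀ i, |c i| ≤ M)
    (c : ι → ℝ) (hc : ∀ i, 0 ≤ c i) (hρ : ‖∑ i, c i • u i‖ ≤ ρ) :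
    ∃ p : ι → ℝ, (∀ i, 0 ≤ p i) ∧ ∑ i, p i • u i = 0 ∧ ∀ i, |c i - p i| ≤ M := by
  classical
  induction hn : (Function.support c).ncard using Nat.strong_induction_on generalizing c with
  | _ n ih =>
  by_cases hli : LinearIndepOn ℝ u (Function.support c)
  · exact ⟨0, by simp, by simp, by simpa using hM c hli hρ⟩
  obtain ⟨z, hz0, hzc, hpos⟩ : ∃ z : ι → ℝ, ∑ i, z i • u i = 0 ∧ (∀ i, c i = 0 → z i = 0) ∧
      ∃ i, 0 < z i := by
    obtain ⟨z, hz0, hzc, i, hi⟩ : ∃ z : ι → ℝ, ∑ i, z i • u i = 0 ∧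
        (∀ i, c i = 0 → z i = 0) ∧ ∃ i, z i ≠ 0 := by
      rw [LinearIndepOn, Fintype.not_linearIndependent_iff] at hli
      obtain ⟨g, hg, i, hi⟩ := hli
      refine ⟨fun i => if h : i ∈ Function.support c then g ⟨i, h⟩ else 0, ?_, ?_, i, ?_⟩
      · rw [← hg]
        symm
        refine Fintype.sum_of_injective _ Subtype.val_injective _ _ (fun i hi => ?_) fun i => ?_
        · have h : ¬ c i ≠ 0 := by simpa using hi
          simp [not_not.mp h]
        · simp
      · intro i hi
        simp [hi]
      · have h : c i ≠ 0 := i.2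
        simpa [h] using hi
    rcases lt_or_gt_of_ne hi with h | h
    · exact ⟨-z, by simp [hz0], fun i hi => by simp [hzc i hi], i, by simpa using h⟩
    · exact ⟨z, hz0, hzc, i, h⟩
  have step : ∀ z : ι → ℝ, ∑ i, z i • u i = 0 → (∀ i, c i = 0 → z i = 0) → (∃ i, 0 < z i) →
      ∃ t : ℝ, 0 < t ∧ ∃ p : ι → ℝ, (∀ i, 0 ≤ p i) ∧ ∑ i, p i • u i = 0 ∧
        ∀ i, |c i - t * z i - p i| ≤ M := by
    intro z hz0 hzc hpos
    obtain ⟨t, ht, hnn, hss⟩ := exists_sub_smul_support_ssubset c z hc hzc hpos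
    refine ⟨t, ht, ih _ (hn ▸ Set.ncard_lt_ncard hss (Set.toFinite _)) _ hnn ?_ rfl⟩
    simpa [sub_smul, Finset.sum_sub_distrib, mul_smul, ← Finset.smul_sum, hz0] using hρ
  obtain ⟨t, ht, p, hp, hp0, hpM⟩ := step z hz0 hzc hpos
  by_cases hneg : ∃ i, z i < 0
  · obtain ⟨s, hs, p', hp', hp0', hpM'⟩ := step (-z) (by simp [hz0])
      (fun i hi => by simp [hzc i hi]) (by simpa using hneg)
    have hst : 0 < s + t := by positivity
    have hone : s / (s + t) + t / (s + t) = 1 := by field_simp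
    refine ⟨fun i => s / (s + t) * p i + t / (s + t) * p' i, fun i => ?_, ?_, fun i => ?_⟩
    · have := hp i
      have := hp' i
      positivity
    · simp [add_smul, Finset.sum_add_distrib, mul_smul, ← Finset.smul_sum, hp0, hp0']
    · have h : c i - (s / (s + t) * p i + t / (s + t) * p' i) =
          s / (s + t) * (c i - t * z i - p i) + t / (s + t) * (c i - s * (-z) i - p' i) := by
        simp only [Pi.neg_apply]
        field_simp
        ring
      rw [h]
      refine (abs_add_le _ _).trans ?_
      rw [abs_mul, abs_mul, abs_of_pos (div_pos hs hst), abs_of_pos (div_pos ht hst)]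
      calc _ ≤ s / (s + t) * M + t / (s + t) * M := by
            gcongr
            · exact hpM i
            · exact hpM' i
        _ = M := by rw [← add_mul, hone, one_mul]
  · push Not at hneg
    refine ⟨fun i => p i + t * z i, fun i => ?_, ?_, fun i => ?_⟩
    · exact add_nonneg (hp i) (mul_nonneg ht.le (hneg i))
    · simp [add_smul, Finset.sum_add_distrib, mul_smul, ← Finset.smul_sum, hp0, hz0]
    · have := hpM i
      rwa [sub_sub, add_comm] at this

lemma exists_coeff_of_mem_cone {d : ℕ} {B : Finset (Fin d → ℤ)} {y : Fin d → ℝ}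
    (hy : y ∈ cone d B) : ∃ c : B → ℝ, (∀ b, 0 ≤ c b) ∧ y = ∑ b, c b • emb d b := by
  obtain ⟨c, hc, rfl⟩ := hy
  exact ⟨fun b => c b, fun b => hc b, (Finset.sum_coe_sort B fun b => c b • emb d b).symm⟩

lemma sum_smul_mem_cone {d : ℕ} {B : Finset (Fin d → ℤ)} (c : B → ℝ) (hc : ∀ b, 0 ≤ c b) :
    ∑ b, c b • emb d b ∈ cone d B := by
  classical
  refine ⟨fun a => if h : a ∈ B then c ⟨a, h⟩ else 0, fun a => ?_, ?_⟩
  · dsimp only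
    split_ifs with h
    exacts [hc _, le_rfl]
  · rw [← Finset.sum_coe_sort B]
    simp

lemma cone_nonempty (d : ℕ) (B : Finset (Fin d → ℤ)) : (cone d B).Nonempty :=
  ⟨0, 0, by simp, by simp⟩

/-- Points of two cones at distance at most `ρ` are near a common point of the cones. -/
lemma exists_mem_inter_cone_near {d K : ℕ} (hd : 1 ≤ d) (hK : 1 ≤ K)
    {B₁ B₂ : Finset (Fin d → ℤ)} (hB : B₁.card ≤ d)
    (hK₁ : ∀ b ∈ B₁, ∀ i, (b i).natAbs ≤ K) (hK₂ : ∀ b ∈ B₂, ∀ i, (b i).natAbs ≤ K)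
    {y₁ y₂ : Fin d → ℝ} (h₁ : y₁ ∈ cone d B₁) (h₂ : y₂ ∈ cone d B₂) {ρ : ℝ} (hρ : 0 < ρ)
    (hy : ‖y₁ - y₂‖ ≤ ρ) :
    ∃ y ∈ cone d B₁ ∩ cone d B₂, ‖y₁ - y‖ ≤ ((d * K : ℕ) : ℝ) ^ (2 * d + 1) * ρ := by
  obtain ⟨c₁, hc₁, rfl⟩ := exists_coeff_of_mem_cone h₁
  obtain ⟨c₂, hc₂, rfl⟩ := exists_coeff_of_mem_cone h₂
  set v : B₁ ⊕ B₂ → Fin d → ℤ := Sum.elim (fun b => b) (fun b => -b) with hv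
  have hvK : ∀ k i, (v k i).natAbs ≤ K := by
    rintro (b | b) i
    · exact hK₁ b b.2 i
    · simpa [hv] using hK₂ b b.2 i
  have hneg : ∀ b : Fin d → ℤ, emb d (-b) = -emb d b := fun b => by ext; simp [emb]
  have hsum : ∀ c : B₁ ⊕ B₂ → ℝ, ∑ k, c k • emb d (v k) =
      ∑ b : B₁, c (.inl b) • emb d b - ∑ b : B₂, c (.inr b) • emb d b := fun c => by
    simp [hv, hneg, sub_eq_add_neg]
  obtain ⟨p, hp, hp0, hpM⟩ := exists_nonneg_relation_near (fun k => emb d (v k)) (ρ := ρ)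
    (M := ((d * K : ℕ) : ℝ) ^ (2 * d) * ρ)
    (fun c hli hc k => by
      classical
      by_cases hk : c k = 0
      · rw [hk, abs_zero]
        positivity
      · refine abs_coeff_le_of_linearIndependent hd hK
          (fun k : Function.support c => v k) hli (fun k i => hvK k i)
          (fun k => c k) hρ ?_ ⟨k, hk⟩
        refine le_of_eq_of_le (congrArg norm ?_) hc
        refine Fintype.sum_of_injective _ Subtype.val_injective _ _ (fun i hi => ?_) fun i => rfl
        have h : ¬ c i ≠ 0 := by simpa using hi
        simp [not_not.mp h])
    (Sum.elim c₁ c₂) (by rintro (b | b) <;> simp [hc₁, hc₂])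
    (by rw [hsum]; simpa using hy)
  rw [hsum, sub_eq_zero] at hp0
  refine ⟨_, ⟨sum_smul_mem_cone (fun b => p (.inl b)) fun b => hp _, ?_⟩, ?_⟩
  · rw [hp0]
    exact sum_smul_mem_cone (fun b => p (.inr b)) fun b => hp _
  · rw [← Finset.sum_sub_distrib]
    refine (norm_sum_le _ _).trans ?_
    have hemb : ∀ b : B₁, ‖emb d b‖ ≤ K := fun b => by
      refine (pi_norm_le_iff_of_nonneg (Nat.cast_nonneg K)).mpr fun i => ?_
      have := hK₁ b b.2 i
      rw [emb, Real.norm_eq_abs, ← Int.cast_abs, Int.abs_eq_natAbs]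
      exact_mod_cast this
    calc _ ≤ ∑ _b : B₁, ((d * K : ℕ) : ℝ) ^ (2 * d) * ρ * K := by
          refine Finset.sum_le_sum fun b _ => ?_
          rw [← sub_smul, norm_smul]
          exact mul_le_mul (hpM (.inl b)) (hemb b) (norm_nonneg _) (by positivity)
      _ = B₁.card * (((d * K : ℕ) : ℝ) ^ (2 * d) * ρ * K) := by simp
      _ ≤ d * (((d * K : ℕ) : ℝ) ^ (2 * d) * ρ * K) := by gcongr
      _ = _ := by push_cast; ring

/-- Intersecting cones: if `x` is within `X₁` of `C_{B₁}` and within `X₂` of `C_{B₂}`, then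
it is within `(X₁+X₂)·2^{2d}·d^{10d⁵}·K^{4d⁵}` of `C_{B₁} ∩ C_{B₂}`. -/
theorem intersecting_cones (d d1 d2 : ℕ) (hd : 1 ≤ d) (hd1 : d1 ≤ d) (hd2 : d2 ≤ d)
    (B1 B2 : Finset (Fin d → ℤ)) (hc1 : B1.card = d1) (hc2 : B2.card = d2)
    (hli1 : LinearIndependent ℝ (fun x : {x // x ∈ B1} => emb d x.1))
    (hli2 : LinearIndependent ℝ (fun x : {x // x ∈ B2} => emb d x.1))
    (K : ℕ) (hK : 1 ≤ K)
    (hKb : ∀ b ∈ B1 ∪ B2, ∀ i, (b i).natAbs ≤ K)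
    (x : Fin d → ℝ) (X1 X2 : ℝ)
    (hX1 : Metric.infDist x (cone d B1) ≤ X1)
    (hX2 : Metric.infDist x (cone d B2) ≤ X2) :
    Metric.infDist x (cone d B1 ∩ cone d B2) ≤
      (X1 + X2) * 2 ^ (2 * d) * (d : ℝ) ^ (10 * d ^ 5) * (K : ℝ) ^ (4 * d ^ 5) := by
  classical
  have hd' : (1 : ℝ) ≤ d := by exact_mod_cast hd
  have hK' : (1 : ℝ) ≤ K := by exact_mod_cast hK
  set C : ℝ := 2 ^ (2 * d) * (d : ℝ) ^ (10 * d ^ 5) * (K : ℝ) ^ (4 * d ^ 5) with hC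
  have hCpos : 0 < C := by positivity
  have hC2 : 1 + ((d * K : ℕ) : ℝ) ^ (2 * d + 1) ≤ C := by
    have hd5 : d ≤ d ^ 5 := Nat.le_self_pow (by norm_num) d
    have h2 : (2 : ℝ) ≤ 2 ^ (2 * d) := le_self_pow₀ (by norm_num) (by omega)
    have h1 : (1 : ℝ) ≤ (d : ℝ) ^ (10 * d ^ 5) * (K : ℝ) ^ (4 * d ^ 5) :=
      one_le_mul_of_one_le_of_one_le (one_le_pow₀ hd') (one_le_pow₀ hK')
    have h3 : ((d * K : ℕ) : ℝ) ^ (2 * d + 1) ≤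
        (d : ℝ) ^ (10 * d ^ 5) * (K : ℝ) ^ (4 * d ^ 5) := by
      push_cast
      rw [mul_pow]
      gcongr <;> first | assumption | omega
    rw [hC, mul_assoc]
    nlinarith
  suffices h : ∀ ρ, X1 + X2 < ρ → Metric.infDist x (cone d B1 ∩ cone d B2) ≤ ρ * C by
    rw [mul_assoc, mul_assoc, ← mul_assoc (2 ^ (2 * d) : ℝ), ← hC, ← div_le_iff₀ hCpos]
    exact le_of_forall_gt_imp_ge_of_dense fun ρ hρ => (div_le_iff₀ hCpos).mpr (h ρ hρ)
  intro ρ hρ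
  obtain ⟨y₁, hy₁, hxy₁⟩ := (Metric.infDist_lt_iff (cone_nonempty d B1)).mp
    (show Metric.infDist x (cone d B1) < X1 + (ρ - (X1 + X2)) / 2 by linarith)
  obtain ⟨y₂, hy₂, hxy₂⟩ := (Metric.infDist_lt_iff (cone_nonempty d B2)).mp
    (show Metric.infDist x (cone d B2) < X2 + (ρ - (X1 + X2)) / 2 by linarith)
  have hn₁ := dist_nonneg (x := x) (y := y₁)
  have hn₂ := dist_nonneg (x := x) (y := y₂)
  have hρ0 : 0 < ρ := by linarith
  obtain ⟨y, hy, hyy⟩ := exists_mem_inter_cone_near hd hK (hc1.trans_le hd1)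
    (fun b hb => hKb b (Finset.mem_union_left _ hb))
    (fun b hb => hKb b (Finset.mem_union_right _ hb)) hy₁ hy₂ hρ0 (by
      rw [← dist_eq_norm]
      linarith [dist_triangle_left y₁ y₂ x])
  rw [← dist_eq_norm] at hyy
  calc Metric.infDist x (cone d B1 ∩ cone d B2) ≤ dist x y := Metric.infDist_le_dist_of_mem hy
    _ ≤ dist x y₁ + dist y₁ y := dist_triangle _ _ _
    _ ≤ ρ * (1 + ((d * K : ℕ) : ℝ) ^ (2 * d + 1)) := by linarith
    _ ≤ ρ * C := by gcongr
end
end
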